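/- There exists a constant τ > 0 such that every P5-free graph G on n ≥ 1 vertices contains a clique or a stable set of size at least n^τ. (That is, the five-vertex path P5 has the Erdős–Hajnal property.) -/

import Mathlib

open Finset
open scoped Classical

/-- A copy of `H` in `G`: an injective map preserving adjacency and non-adjacency. -/
def IsCopy {W V : Type*} (H : SimpleGraph W) (G : SimpleGraph V) (f : W → V) : Prop :=
  Function.Injective f ∧ ∀ u v : W, H.Adj u v ↔ G.Adj (f u) (f v)

/-- `G` is `H`-free: there is no copy of `H` in `G`. -/
def Free {W V : Type*} (H : SimpleGraph W) (G : SimpleGraph V) : Prop :=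
  ¬ ∃ f : W → V, IsCopy H G f

/-- The path on five vertices. -/
def P5 : SimpleGraph (Fin 5) := SimpleGraph.pathGraph 5

/-- The neighbours of `v` inside the finite set `A`. -/
noncomputable def nbrsIn {V : Type*} (G : SimpleGraph V) (v : V) (A : Finset V) : Finset V :=
  A.filter (fun u => G.Adj v u)

/-- `G` is `x`-sparse: every vertex has degree at most `x * |G|`. -/
def Sparse {V : Type*} [Fintype V] (G : SimpleGraph V) (x : ℝ) : Prop :=
  ∀ v : V, ((nbrsIn G v Finset.univ).card : ℝ) ≤ x * (Fintype.card V : ℝ)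

/-- `G` is `x`-restricted: `G` or its complement is `x`-sparse. -/
def Restricted {V : Type*} [Fintype V] (G : SimpleGraph V) (x : ℝ) : Prop :=
  Sparse G x ∨ Sparse Gᶜ x

/-- The induced subgraph `G[S]` is `x`-sparse. -/
def SparseOn {V : Type*} (G : SimpleGraph V) (S : Finset V) (x : ℝ) : Prop :=
  ∀ v ∈ S, ((nbrsIn G v S).card : ℝ) ≤ x * (S.card : ℝ)

/-- The induced subgraph `G[S]` is `x`-restricted: it or its complement is `x`-sparse. -/
def RestrictedOn {V : Type*} (G : SimpleGraph V) (S : Finset V) (x : ℝ) : Prop :=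
  SparseOn G S x ∨ SparseOn Gᶜ S x

/-- `(A, B)` is complete in `G`. -/
def CompletePair {V : Type*} (G : SimpleGraph V) (A B : Finset V) : Prop :=
  ∀ a ∈ A, ∀ b ∈ B, G.Adj a b

/-- `(A, B)` is anticomplete in `G`. -/
def AnticompletePair {V : Type*} (G : SimpleGraph V) (A B : Finset V) : Prop :=
  ∀ a ∈ A, ∀ b ∈ B, ¬ G.Adj a b

/-- `B` is `x`-sparse to `A` in `G`: every vertex of `B` has at most `x * |A|` neighbours in `A`. -/
def SparseTo {V : Type*} (G : SimpleGraph V) (x : ℝ) (A B : Finset V) : Prop :=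
  ∀ v ∈ B, ((nbrsIn G v A).card : ℝ) ≤ x * (A.card : ℝ)

/-- The number of edges of `G` between `A` and `B`. -/
noncomputable def edgesBetween {V : Type*} (G : SimpleGraph V) (A B : Finset V) : ℕ :=
  ((A ×ˢ B).filter (fun p => G.Adj p.1 p.2)).card

/-- `(A, B)` is weakly `x`-sparse in `G`. -/
def WeaklySparse {V : Type*} (G : SimpleGraph V) (x : ℝ) (A B : Finset V) : Prop :=
  (edgesBetween G A B : ℝ) ≤ x * (A.card : ℝ) * (B.card : ℝ)

/-- A blockade: a sequence of pairwise disjoint vertex subsets. -/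
def IsBlockade {V : Type*} {n : ℕ} (B : Fin n → Finset V) : Prop :=
  ∀ i j : Fin n, i ≠ j → Disjoint (B i) (B j)

/-- A pure blockade: every pair of distinct blocks is complete or anticomplete. -/
def PureBlockade {V : Type*} (G : SimpleGraph V) {n : ℕ} (B : Fin n → Finset V) : Prop :=
  ∀ i j : Fin n, i ≠ j → CompletePair G (B i) (B j) ∨ AnticompletePair G (B i) (B j)

/-- A complete blockade. -/
def CompleteBlockade {V : Type*} (G : SimpleGraph V) {n : ℕ} (B : Fin n → Finset V) : Prop :=
  ∀ i j : Fin n, i ≠ j → CompletePair G (B i) (B j)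

/-- An anticomplete blockade. -/
def AnticompleteBlockade {V : Type*} (G : SimpleGraph V) {n : ℕ} (B : Fin n → Finset V) : Prop :=
  ∀ i j : Fin n, i ≠ j → AnticompletePair G (B i) (B j)

/-- An `x`-sparse blockade: `B j` is `x`-sparse to `B i` whenever `i < j`. -/
def SparseBlockade {V : Type*} (G : SimpleGraph V) (x : ℝ) {n : ℕ} (B : Fin n → Finset V) : Prop :=
  ∀ i j : Fin n, i < j → SparseTo G x (B i) (B j)

/-- A comb: a blockade `Bl` together with distinct apexes `a i`, outside all blocks, such that
`a i` is adjacent to all of `Bl i` and nonadjacent to all of `Bl j` for `j ≠ i`. -/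
def IsComb {V : Type*} (G : SimpleGraph V) {k : ℕ} (a : Fin k → V) (Bl : Fin k → Finset V) :
    Prop :=
  IsBlockade Bl ∧ Function.Injective a ∧ (∀ i j : Fin k, a i ∉ Bl j) ∧
  (∀ i : Fin k, ∀ v ∈ Bl i, G.Adj (a i) v) ∧
  (∀ i j : Fin k, i ≠ j → ∀ v ∈ Bl j, ¬ G.Adj (a i) v)

namespace P5EH

/-- `G` contains no induced house: a four-cycle `a b c d` with a roof `r` over the edge `a b`. -/
def HouseFree {V : Type*} (G : SimpleGraph V) : Prop :=
  ∀ a b c d r : V, G.Adj a b → G.Adj b c → G.Adj c d → G.Adj d a → ¬ G.Adj a c → ¬ G.Adj b d →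
    G.Adj r a → G.Adj r b → ¬ G.Adj r c → ¬ G.Adj r d → False

/-- The closed neighbourhood of `w` inside `Q`. -/
noncomputable def clN {V : Type*} (H : SimpleGraph V) (w : V) (Q : Finset V) : Finset V :=
  Q.filter (fun u => u = w ∨ H.Adj w u)

/-- `U` contains `k` pairwise disjoint, pairwise `H`-anticomplete sets of size at least `w`. -/
def Blockade {V : Type*} (H : SimpleGraph V) (U : Finset V) (k : ℕ) (w : ℝ) : Prop :=
  ∃ (ι : Type) (_ : Fintype ι) (X : ι → Finset V), Fintype.card ι = k ∧
    (∀ i, X i ⊆ U ∧ w ≤ ((X i).card : ℝ)) ∧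
    ∀ i j, i ≠ j → Disjoint (X i) (X j) ∧ AnticompletePair H (X i) (X j)

theorem houseFree_compl {V : Type*} {G : SimpleGraph V} (h : Free P5 G) : HouseFree Gᶜ := by
  intro a b c d r hab hbc hcd hda hac hbd hra hrb hrc hrd
  have hac' : a ≠ c := fun e => hrc (e ▸ hra)
  have hbd' : b ≠ d := fun e => hrd (e ▸ hrb)
  have hrc' : r ≠ c := fun e => hac ((e ▸ hra).symm)
  have hrd' : r ≠ d := fun e => hbd ((e ▸ hrb).symm)
  simp only [SimpleGraph.compl_adj, not_and, not_not] at hab hbc hcd hda hac hbd hra hrb hrc hrd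
  replace hac := hac hac'
  replace hbd := hbd hbd'
  replace hrc := hrc hrc'
  replace hrd := hrd hrd'
  obtain ⟨hab1, hab⟩ := hab
  obtain ⟨hbc1, hbc⟩ := hbc
  obtain ⟨hcd1, hcd⟩ := hcd
  obtain ⟨hda1, hda⟩ := hda
  obtain ⟨hra1, hra⟩ := hra
  obtain ⟨hrb1, hrb⟩ := hrb
  apply h
  refine ⟨![a, c, r, d, b], ?_, ?_⟩
  · intro i j hij
    fin_cases i <;> fin_cases j <;> simp_all
  · have hsym := fun x y => G.adj_comm x y
    intro i j
    fin_cases i <;> fin_cases j <;>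
      simp [P5, SimpleGraph.pathGraph_adj, SimpleGraph.irrefl] <;>
      first | assumption | (rw [hsym]; assumption)

section House
variable {V : Type*} {G : SimpleGraph V}

theorem HouseFree.no_crossing (h : HouseFree G) {v b w w' i i' : V}
    (hvw : G.Adj v w) (hvi : G.Adj v i) (hvi' : G.Adj v i')
    (hbv : ¬ G.Adj b v) (hbi : G.Adj b i) (hbi' : G.Adj b i') (hbw : ¬ G.Adj b w)
    (hbw' : ¬ G.Adj b w') (hww : G.Adj w w') (hiw : G.Adj i w) (hiw' : ¬ G.Adj i w')
    (hi'w' : G.Adj i' w') (hi'w : ¬ G.Adj i' w) : False := by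
  by_cases hii : G.Adj i i'
  · exact h i i' w' w b hii hi'w' hww.symm hiw.symm hiw' hi'w hbi hbi' hbw' hbw
  · exact h v i b i' w hvi hbi.symm hbi' hvi'.symm (fun e => hbv e.symm) hii hvw.symm hiw.symm
      (fun e => hbw e.symm) (fun e => hi'w e.symm)

theorem HouseFree.no_mixed (h : HouseFree G) {v b x x' u : V}
    (hvx : G.Adj v x) (hvx' : G.Adj v x') (hvu : G.Adj v u) (hbv : ¬ G.Adj b v)
    (hbx : G.Adj b x) (hbx' : G.Adj b x') (hxx : ¬ G.Adj x x') (hux : G.Adj u x)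
    (hux' : ¬ G.Adj u x') (hbu : ¬ G.Adj b u) : False :=
  h v x b x' u hvx hbx.symm hbx' hvx'.symm (fun e => hbv e.symm) hxx hvu.symm hux
    (fun e => hbu e.symm) hux'

/-- There is no induced five-vertex path in the complement of a house-free graph. -/
theorem HouseFree.no_path (h : HouseFree G) {v1 v2 v3 v4 v5 : V}
    (h12 : Gᶜ.Adj v1 v2) (h23 : Gᶜ.Adj v2 v3) (h34 : Gᶜ.Adj v3 v4) (h45 : Gᶜ.Adj v4 v5)
    (h13 : G.Adj v1 v3) (h14 : G.Adj v1 v4) (h15 : G.Adj v1 v5) (h24 : G.Adj v2 v4)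
    (h25 : G.Adj v2 v5) (h35 : G.Adj v3 v5) : False :=
  h v1 v5 v2 v4 v3 h15 h25.symm h24 h14.symm h12.2 (fun e => h45.2 e.symm) h13.symm h35
    (fun e => h23.2 e.symm) h34.2

end House

section ClosedNbhd
variable {V : Type*} {H : SimpleGraph V}

theorem mem_clN {w u : V} {Q : Finset V} : u ∈ clN H w Q ↔ u ∈ Q ∧ (u = w ∨ H.Adj w u) := by
  simp [clN]

theorem clN_mono {w : V} {Q R : Finset V} (h : Q ⊆ R) : clN H w Q ⊆ clN H w R :=
  Finset.filter_subset_filter _ h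

theorem clN_subset {w : V} {Q : Finset V} : clN H w Q ⊆ Q := Finset.filter_subset _ _

theorem self_mem_clN {w : V} {Q : Finset V} (h : w ∈ Q) : w ∈ clN H w Q := by
  simp [mem_clN, h]

end ClosedNbhd

section Comb

/-- Greedy colouring: each row of weights is split into four, and the colour classes are chosen from
the last index down. -/
theorem exists_greedy_coloring (w : ℕ → ℕ → ℕ) (J : Finset ℕ) :
    ∃ c : ℕ → Fin 4, ∀ j ∈ J,
      4 * ∑ l ∈ J.filter (fun l => j < l ∧ c l = c j), w j l ≤
        ∑ l ∈ J.filter (fun l => j < l), w j l := by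
  induction J using Finset.induction_on_min with
  | empty => exact ⟨fun _ => 0, by simp⟩
  | insert a s ha ih =>
    obtain ⟨c, hc⟩ := ih
    have key : ∃ q : Fin 4, 4 * ∑ l ∈ s.filter (fun l => c l = q), w a l ≤ ∑ l ∈ s, w a l := by
      by_contra! hcon
      have h1 := Finset.sum_fiberwise s c (fun l => w a l)
      rw [Fin.sum_univ_four] at h1
      have := hcon 0
      have := hcon 1
      have := hcon 2
      have := hcon 3
      omega
    obtain ⟨q, hq⟩ := key
    have hne : ∀ l ∈ s, l ≠ a := fun l hl e => by have := ha l hl; omega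
    refine ⟨Function.update c a q, fun j hj => ?_⟩
    rcases Finset.mem_insert.1 hj with rfl | hj
    · have e1 : (insert j s).filter (fun l => j < l ∧ Function.update c j q l =
          Function.update c j q j) = s.filter (fun l => c l = q) := by
        ext l
        simp only [Finset.mem_filter, Finset.mem_insert, Function.update_self]
        constructor
        · rintro ⟨rfl | h, h1, h2⟩
          · omega
          · rw [Function.update_of_ne (hne l h)] at h2
            exact ⟨h, h2⟩
        · rintro ⟨h, h2⟩
          rw [Function.update_of_ne (hne l h)]
          exact ⟨Or.inr h, ha l h, h2⟩
      have e2 : (insert j s).filter (fun l => j < l) = s := by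
        ext l
        simp only [Finset.mem_filter, Finset.mem_insert]
        constructor
        · rintro ⟨rfl | h, h1⟩
          · omega
          · exact h
        · exact fun h => ⟨Or.inr h, ha l h⟩
      rw [e1, e2]
      exact hq
    · have haj := ha j hj
      have e1 : (insert a s).filter (fun l => j < l ∧ Function.update c a q l =
          Function.update c a q j) = s.filter (fun l => j < l ∧ c l = c j) := by
        ext l
        simp only [Finset.mem_filter, Finset.mem_insert]
        rw [Function.update_of_ne (hne j hj)]
        constructor
        · rintro ⟨rfl | h, h1, h2⟩
          · omega
          · rw [Function.update_of_ne (hne l h)] at h2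
            exact ⟨h, h1, h2⟩
        · rintro ⟨h, h1, h2⟩
          rw [Function.update_of_ne (hne l h)]
          exact ⟨Or.inr h, h1, h2⟩
      have e2 : (insert a s).filter (fun l => j < l) = s.filter (fun l => j < l) := by
        ext l
        simp only [Finset.mem_filter, Finset.mem_insert]
        constructor
        · rintro ⟨rfl | h, h1⟩
          · omega
          · exact ⟨h, h1⟩
        · exact fun h => ⟨Or.inr h.1, h.2⟩
      rw [e1, e2]
      exact hc j hj

variable {V : Type*}

/-- The elements of `M` related to `i j` but to no earlier `i l`. -/
noncomputable def newNbrs (r : V → V → Prop) (M : Finset V) (i : ℕ → V) (j : ℕ) : Finset V :=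
  M.filter (fun w => r (i j) w ∧ ∀ l < j, ¬ r (i l) w)

theorem newNbrs_disjoint (r : V → V → Prop) (M : Finset V) (i : ℕ → V) {j l : ℕ} (h : j ≠ l) :
    Disjoint (newNbrs r M i j) (newNbrs r M i l) := by
  rw [Finset.disjoint_left]
  intro w h1 h2
  simp only [newNbrs, Finset.mem_filter] at h1 h2
  rcases lt_or_gt_of_ne h with h | h
  · exact h2.2.2 j h h1.2.1
  · exact h1.2.2 l h h2.2.1

/-- A long sequence of new neighbourhoods contains a large comb. -/
theorem exists_comb_of_sequence (r : V → V → Prop) (K M : Finset V) (s m : ℕ) (i : ℕ → V)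
    (hdeg : ∀ x ∈ K, (M.filter (r x)).card ≤ s)
    (hi : ∀ j < m, i j ∈ K ∧ s < 2 * (newNbrs r M i j).card) :
    ∃ (k : ℕ) (a : Fin k → V) (D : Fin k → Finset V),
      (∀ j, a j ∈ K ∧ D j ⊆ M ∧ ∀ w ∈ D j, r (a j) w) ∧
      (∀ j l, j ≠ l → ∀ w ∈ D j, ¬ r (a l) w) ∧
      (∀ j, s ≤ 4 * (D j).card) ∧ m ≤ 8 * k := by
  set E := newNbrs r M i with hE
  set wt : ℕ → ℕ → ℕ := fun j l => ((E j).filter (r (i l))).card with hwt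
  have hcol : ∀ l < m, 2 * ∑ j ∈ (range m).filter (fun j => j < l), wt j l ≤ s := by
    intro l hl
    have h1 : ∑ j ∈ (range m).filter (fun j => j < l), wt j l + (E l).card ≤ s := by
      have hd : (((range m).filter (fun j => j < l)).biUnion
          (fun j => (E j).filter (r (i l)))).card =
          ∑ j ∈ (range m).filter (fun j => j < l), wt j l := by
        apply Finset.card_biUnion
        intro x _ y _ hxy
        exact (newNbrs_disjoint r M i hxy).mono (Finset.filter_subset _ _)
          (Finset.filter_subset _ _)
      rw [← hd, ← Finset.card_union_of_disjoint]
      · refine le_trans (Finset.card_le_card ?_) (hdeg (i l) (hi l hl).1)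
        intro w hw
        simp only [Finset.mem_union, Finset.mem_biUnion, Finset.mem_filter, hE, newNbrs] at hw ⊢
        rcases hw with ⟨j, _, h⟩ | h
        · exact ⟨h.1.1, h.2⟩
        · exact ⟨h.1, h.2.1⟩
      · rw [Finset.disjoint_biUnion_left]
        intro j hj
        simp only [Finset.mem_filter] at hj
        exact (newNbrs_disjoint r M i (by omega)).mono_left (Finset.filter_subset _ _)
    have := (hi l hl).2
    omega
  set row : ℕ → ℕ := fun j => ∑ l ∈ (range m).filter (fun l => j < l), wt j l with hrow
  have hrows : 2 * ∑ j ∈ range m, row j ≤ m * s := by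
    have h1 : ∑ j ∈ range m, row j =
        ∑ l ∈ range m, ∑ j ∈ (range m).filter (fun j => j < l), wt j l := by
      simp only [hrow, Finset.sum_filter]
      exact Finset.sum_comm
    rw [h1, Finset.mul_sum]
    calc _ ≤ ∑ l ∈ range m, s := Finset.sum_le_sum fun l hl => hcol l (Finset.mem_range.1 hl)
      _ = m * s := by simp
  set J := (range m).filter (fun j => row j ≤ s) with hJ
  have hJc : m ≤ 2 * J.card := by
    have h1 : J.card + ((range m).filter (fun j => ¬ row j ≤ s)).card = m := by
      rw [hJ, Finset.card_filter_add_card_filter_not, Finset.card_range]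
    set b := ((range m).filter (fun j => ¬ row j ≤ s)).card with hb
    have h2 : b * (s + 1) ≤ ∑ j ∈ range m, row j := by
      calc b * (s + 1) = ∑ j ∈ (range m).filter (fun j => ¬ row j ≤ s), (s + 1) := by
            rw [Finset.sum_const, smul_eq_mul]
        _ ≤ ∑ j ∈ (range m).filter (fun j => ¬ row j ≤ s), row j := by
            apply Finset.sum_le_sum
            intro j hj
            have := (Finset.mem_filter.1 hj).2
            omega
        _ ≤ _ := Finset.sum_le_sum_of_subset (Finset.filter_subset _ _)
    have h3 : 2 * b ≤ m := by
      by_contra hc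
      have : (m + 1) * (s + 1) ≤ 2 * b * (s + 1) := Nat.mul_le_mul_right _ (by omega)
      nlinarith
    omega
  obtain ⟨c, hc⟩ := exists_greedy_coloring wt J
  obtain ⟨q, hq⟩ : ∃ q : Fin 4, J.card ≤ 4 * (J.filter (fun l => c l = q)).card := by
    by_contra! hcon
    have h1 := Finset.card_eq_sum_card_fiberwise (f := c) (s := J) (t := Finset.univ)
      (fun _ _ => Finset.mem_coe.2 (Finset.mem_univ _))
    rw [Fin.sum_univ_four] at h1
    have := hcon 0
    have := hcon 1
    have := hcon 2
    have := hcon 3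
    omega
  set J' := J.filter (fun l => c l = q) with hJ'
  have hmemJ' : ∀ j ∈ J', j ∈ J ∧ c j = q ∧ j < m ∧ row j ≤ s := by
    intro j hj
    rw [hJ', Finset.mem_filter] at hj
    have h := hj.1
    rw [hJ, Finset.mem_filter, Finset.mem_range] at h
    exact ⟨hj.1, hj.2, h.1, h.2⟩
  set e := J'.equivFin.symm with he
  refine ⟨J'.card, fun x => i (e x), fun x => (E (e x)).filter
    (fun w => ∀ l ∈ J', l ≠ (e x : ℕ) → ¬ r (i l) w), ?_, ?_, ?_, by omega⟩
  · intro x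
    refine ⟨(hi _ (hmemJ' _ (e x).2).2.2.1).1, ?_, ?_⟩
    · exact (Finset.filter_subset _ _).trans (Finset.filter_subset _ _)
    · intro w hw
      simp only [Finset.mem_filter, hE, newNbrs] at hw
      exact hw.1.2.1
  · intro x y hxy w hw
    simp only [Finset.mem_filter] at hw
    exact hw.2 _ (e y).2 fun h => hxy (e.injective (Subtype.ext h.symm))
  · intro x
    obtain ⟨hxJ, hxq, hxm, hxs⟩ := hmemJ' _ (e x).2
    set j : ℕ := (e x : ℕ)
    set D := (E j).filter (fun w => ∀ l ∈ J', l ≠ j → ¬ r (i l) w) with hD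
    have hsub : E j ⊆ D ∪ (J.filter (fun l => j < l ∧ c l = c j)).biUnion
        (fun l => (E j).filter (r (i l))) := by
      intro w hw
      by_cases h : ∀ l ∈ J', l ≠ j → ¬ r (i l) w
      · exact Finset.mem_union_left _ (Finset.mem_filter.2 ⟨hw, h⟩)
      · push Not at h
        obtain ⟨l, hl, hlj, hr⟩ := h
        apply Finset.mem_union_right
        rw [Finset.mem_biUnion]
        refine ⟨l, ?_, Finset.mem_filter.2 ⟨hw, hr⟩⟩
        obtain ⟨hlJ, hlq, -⟩ := hmemJ' l hl
        refine Finset.mem_filter.2 ⟨hlJ, ?_, hlq.trans hxq.symm⟩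
        rcases lt_or_gt_of_ne hlj with h | h
        · simp only [hE, newNbrs, Finset.mem_filter] at hw
          exact absurd hr (hw.2.2 l h)
        · exact h
    have h1 := Finset.card_le_card hsub
    have h2 := Finset.card_union_le D ((J.filter (fun l => j < l ∧ c l = c j)).biUnion
        (fun l => (E j).filter (r (i l))))
    have h3 : ((J.filter (fun l => j < l ∧ c l = c j)).biUnion
        (fun l => (E j).filter (r (i l)))).card ≤
        ∑ l ∈ J.filter (fun l => j < l ∧ c l = c j), wt j l := Finset.card_biUnion_le
    have h4 := hc j hxJ
    have h5 : ∑ l ∈ J.filter (fun l => j < l), wt j l ≤ row j := by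
      apply Finset.sum_le_sum_of_subset
      exact Finset.filter_subset_filter _ (Finset.filter_subset _ _)
    have h6 := (hi j hxm).2
    change s ≤ 4 * D.card
    omega

/-- The comb lemma. -/
theorem exists_comb (r : V → V → Prop) (K : Finset V) (N : ℕ) (s : ℕ) (M : Finset V)
    (hcov : ∀ w ∈ M, ∃ x ∈ K, r x w) (hdeg : ∀ x ∈ K, (M.filter (r x)).card ≤ s)
    (hM : M.Nonempty) (hN : 16 * N * s ≤ M.card ^ 2) :
    ∃ (k : ℕ) (a : Fin k → V) (D : Fin k → Finset V),
      (∀ j, a j ∈ K ∧ D j ⊆ M ∧ ∀ w ∈ D j, r (a j) w) ∧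
      (∀ j l, j ≠ l → ∀ w ∈ D j, ¬ r (a l) w) ∧
      (∀ j, N ≤ 256 * k ^ 2 * (D j).card) ∧ N ≤ 64 * k ^ 2 * s := by
  induction s using Nat.strong_induction_on generalizing M with
  | _ s ih =>
  have hs : 1 ≤ s := by
    obtain ⟨w, hw⟩ := hM
    obtain ⟨x, hx, hr⟩ := hcov w hw
    exact le_trans (Finset.card_pos.2 ⟨w, Finset.mem_filter.2 ⟨hw, hr⟩⟩) (hdeg x hx)
  let P : ℕ → Prop := fun m => ∃ i : ℕ → V, ∀ j < m, i j ∈ K ∧ s < 2 * (newNbrs r M i j).card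
  have hbound : ∀ m, P m → m ≤ M.card := by
    rintro m ⟨i, hi⟩
    calc m = ∑ j ∈ range m, 1 := by simp
      _ ≤ ∑ j ∈ range m, (newNbrs r M i j).card := by
          apply Finset.sum_le_sum
          intro j hj
          have := (hi j (Finset.mem_range.1 hj)).2
          omega
      _ = ((range m).biUnion (newNbrs r M i)).card := by
          rw [Finset.card_biUnion]
          intro x _ y _ hxy
          exact newNbrs_disjoint r M i hxy
      _ ≤ M.card := Finset.card_le_card (Finset.biUnion_subset.2
          fun j _ => Finset.filter_subset _ _)
  obtain ⟨v0, hv0⟩ := hM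
  have hP0 : P 0 := ⟨fun _ => v0, by simp⟩
  obtain ⟨m, ⟨i, hi⟩, hmax⟩ : ∃ m, P m ∧ ¬ P (m + 1) := by
    by_contra! hcon
    have : ∀ m, P m := fun m => Nat.rec hP0 (fun n hn => hcon n hn) m
    have := hbound _ (this (M.card + 1))
    omega
  by_cases hms : N ≤ m ^ 2 * s
  · obtain ⟨k, a, D, h1, h2, h3, h4⟩ := exists_comb_of_sequence r K M s m i hdeg hi
    have h5 : m ^ 2 ≤ 64 * k ^ 2 := by nlinarith
    have h6 : N ≤ 64 * k ^ 2 * s := hms.trans (Nat.mul_le_mul_right _ h5)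
    refine ⟨k, a, D, h1, h2, fun j => h6.trans ?_, h6⟩
    calc 64 * k ^ 2 * s ≤ 64 * k ^ 2 * (4 * (D j).card) := Nat.mul_le_mul_left _ (h3 j)
      _ = _ := by ring
  · push Not at hms
    set M' := M.filter (fun w => ∀ l < m, ¬ r (i l) w) with hM'
    have hsm : (m * s) ^ 2 * 16 ≤ M.card ^ 2 := by
      refine le_trans ?_ hN
      have : m ^ 2 * s * s ≤ N * s := Nat.mul_le_mul_right _ hms.le
      nlinarith
    have hsm' : 4 * (m * s) ≤ M.card := by
      by_contra! hc
      nlinarith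
    have hcard : M.card ≤ M'.card + m * s := by
      have hsub : M ⊆ M' ∪ (range m).biUnion (fun l => M.filter (r (i l))) := by
        intro w hw
        by_cases h : ∀ l < m, ¬ r (i l) w
        · exact Finset.mem_union_left _ (Finset.mem_filter.2 ⟨hw, h⟩)
        · push Not at h
          obtain ⟨l, hl, hr⟩ := h
          exact Finset.mem_union_right _ (Finset.mem_biUnion.2
            ⟨l, Finset.mem_range.2 hl, Finset.mem_filter.2 ⟨hw, hr⟩⟩)
      refine (Finset.card_le_card hsub).trans ((Finset.card_union_le _ _).trans ?_)
      gcongr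
      refine Finset.card_biUnion_le.trans ?_
      calc _ ≤ ∑ l ∈ range m, s :=
            Finset.sum_le_sum fun l hl => hdeg _ (hi l (Finset.mem_range.1 hl)).1
        _ = m * s := by simp
    have hMpos : 0 < M.card := Finset.card_pos.2 ⟨v0, hv0⟩
    have hdeg' : ∀ x ∈ K, (M'.filter (r x)).card ≤ s / 2 := by
      intro x hx
      by_contra! hc
      apply hmax
      refine ⟨Function.update i m x, fun j hj => ?_⟩
      rcases Nat.lt_succ_iff_lt_or_eq.1 hj with hj | rfl
      · have e1 : newNbrs r M (Function.update i m x) j = newNbrs r M i j := by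
          unfold newNbrs
          apply Finset.filter_congr
          intro w _
          rw [Function.update_of_ne (by omega)]
          have : (∀ l < j, ¬ r (Function.update i m x l) w) ↔ ∀ l < j, ¬ r (i l) w := by
            refine forall₂_congr fun l hl => ?_
            rw [Function.update_of_ne (by omega)]
          rw [this]
        rw [e1, Function.update_of_ne (by omega)]
        exact hi j hj
      · rw [Function.update_self]
        refine ⟨hx, ?_⟩
        have e1 : newNbrs r M (Function.update i j x) j = M'.filter (r x) := by
          ext w
          simp only [newNbrs, hM', Finset.mem_filter, Function.update_self]
          have : (∀ l < j, ¬ r (Function.update i j x l) w) ↔ ∀ l < j, ¬ r (i l) w := by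
            refine forall₂_congr fun l hl => ?_
            rw [Function.update_of_ne (by omega)]
          rw [this]
          tauto
        rw [e1]
        omega
    obtain ⟨k, a, D, h1, h2, h3, h4⟩ := ih (s / 2) (by omega) M'
      (fun w hw => hcov w (Finset.mem_filter.1 hw).1) hdeg'
      (Finset.card_pos.1 (by omega)) (by
        have h5 : 2 * (s / 2) ≤ s := by omega
        have h6 : 16 * N * (s / 2) * 2 ≤ M.card ^ 2 := by nlinarith
        have h7 : 3 * M.card ≤ 4 * M'.card := by omega
        nlinarith)
    refine ⟨k, a, D, fun j => ⟨(h1 j).1, (h1 j).2.1.trans (Finset.filter_subset _ _), (h1 j).2.2⟩,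
      h2, h3, h4.trans (Nat.mul_le_mul_left _ (by omega))⟩

end Comb

section Nest
variable {V : Type*} {G : SimpleGraph V}

/-- If the neighbourhoods of adjacent vertices of `Q` are nearly nested, then `Q` has a large subset
that is very dense or very sparse. -/
theorem nest {Q : Finset V} {m e : ℝ} (hm : 1 ≤ m) (he : 0 < e)
    (hQ : ∀ w ∈ Q, ∀ w' ∈ Q, G.Adj w w' →
      ((Q.filter (fun u => G.Adj w u ∧ ¬ G.Adj w' u)).card : ℝ) < m ∨
      ((Q.filter (fun u => G.Adj w' u ∧ ¬ G.Adj w u)).card : ℝ) < m) :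
    (∃ C ⊆ Q, e ≤ (C.card : ℝ) ∧ ∀ c ∈ C, ((clN Gᶜ c C).card : ℝ) ≤ m) ∨
    (∃ Q' ⊆ Q, Q.card ≤ 2 * Q'.card ∧ ∀ w ∈ Q', ((clN G w Q).card : ℝ) ≤ 4 * e) := by
  set deg : V → ℕ := fun w => (Q.filter (G.Adj w)).card with hdeg
  set out : V → Finset V := fun w => Q.filter (fun u => u = w ∨ (G.Adj w u ∧ deg w ≤ deg u))
    with hout
  by_cases hbig : ∃ w ∈ Q, e ≤ ((out w).card : ℝ)
  · left
    obtain ⟨w, hw, hwe⟩ := hbig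
    refine ⟨out w, Finset.filter_subset _ _, hwe, fun c hc => ?_⟩
    obtain ⟨hcQ, hc⟩ := Finset.mem_filter.1 hc
    rcases hc with rfl | ⟨hadj, hle⟩
    · refine le_trans ?_ hm
      have : clN Gᶜ c (out c) ⊆ {c} := by
        intro u hu
        obtain ⟨hu1, hu2⟩ := mem_clN.1 hu
        rw [Finset.mem_singleton]
        rcases (Finset.mem_filter.1 hu1).2 with h | h
        · exact h
        · rcases hu2 with h' | h'
          · exact h'
          · exact absurd h.1 h'.2
      exact_mod_cast (Finset.card_le_card this)
    · have hsub : clN Gᶜ c (out w) ⊆ Q.filter (fun u => G.Adj w u ∧ ¬ G.Adj c u) := by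
        intro u hu
        obtain ⟨hu1, hu2⟩ := mem_clN.1 hu
        obtain ⟨hu1, hu3⟩ := Finset.mem_filter.1 hu1
        refine Finset.mem_filter.2 ⟨hu1, ?_⟩
        rcases hu2 with rfl | hu2
        · exact ⟨hadj, G.irrefl⟩
        · refine ⟨?_, hu2.2⟩
          rcases hu3 with rfl | h
          · exact absurd hadj.symm hu2.2
          · exact h.1
      have h1 := Finset.card_le_card hsub
      have h2 : (Q.filter (fun u => G.Adj w u ∧ ¬ G.Adj c u)).card ≤
          (Q.filter (fun u => G.Adj c u ∧ ¬ G.Adj w u)).card := by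
        have e1 : (Q.filter (fun u => G.Adj w u ∧ ¬ G.Adj c u)).card +
            (Q.filter (fun u => G.Adj w u ∧ G.Adj c u)).card = deg w := by
          rw [← Finset.filter_filter, ← Finset.filter_filter, add_comm]
          exact Finset.card_filter_add_card_filter_not _
        have e2 : (Q.filter (fun u => G.Adj c u ∧ ¬ G.Adj w u)).card +
            (Q.filter (fun u => G.Adj c u ∧ G.Adj w u)).card = deg c := by
          rw [← Finset.filter_filter, ← Finset.filter_filter, add_comm]
          exact Finset.card_filter_add_card_filter_not _
        have e3 : Q.filter (fun u => G.Adj w u ∧ G.Adj c u) =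
            Q.filter (fun u => G.Adj c u ∧ G.Adj w u) := by
          apply Finset.filter_congr
          intro u _
          exact and_comm
        rw [e3] at e1
        omega
      have h1' : ((clN Gᶜ c (out w)).card : ℝ) ≤
          ((Q.filter (fun u => G.Adj w u ∧ ¬ G.Adj c u)).card : ℝ) := by exact_mod_cast h1
      have h2' : ((Q.filter (fun u => G.Adj w u ∧ ¬ G.Adj c u)).card : ℝ) ≤
          ((Q.filter (fun u => G.Adj c u ∧ ¬ G.Adj w u)).card : ℝ) := by exact_mod_cast h2
      rcases hQ w hw c hcQ hadj with h | h <;> linarith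
  · right
    push Not at hbig
    have hsum : ∑ w ∈ Q, ((clN G w Q).card : ℝ) ≤ 2 * (e * Q.card) := by
      have h1 : ∀ w ∈ Q, (clN G w Q).card ≤
          (out w).card + (Q.filter (fun u => w ∈ out u)).card := by
        intro w hw
        refine le_trans (Finset.card_le_card ?_) (Finset.card_union_le _ _)
        intro u hu
        obtain ⟨hu1, hu2⟩ := mem_clN.1 hu
        simp only [hout, Finset.mem_union, Finset.mem_filter]
        rcases hu2 with rfl | hu2
        · exact Or.inl ⟨hu1, Or.inl rfl⟩
        · rcases le_total (deg w) (deg u) with h | h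
          · exact Or.inl ⟨hu1, Or.inr ⟨hu2, h⟩⟩
          · exact Or.inr ⟨hu1, hw, Or.inr ⟨hu2.symm, h⟩⟩
      have h2 : ∑ w ∈ Q, (Q.filter (fun u => w ∈ out u)).card = ∑ u ∈ Q, (out u).card := by
        have e1 := Finset.sum_card_bipartiteAbove_eq_sum_card_bipartiteBelow
          (s := Q) (t := Q) (fun w u => w ∈ out u)
        simp only [Finset.bipartiteAbove, Finset.bipartiteBelow] at e1
        rw [e1]
        refine Finset.sum_congr rfl fun u _ => congrArg Finset.card ?_
        ext x
        simp only [hout, Finset.mem_filter]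
        tauto
      have h3 : ∑ w ∈ Q, ((out w).card : ℝ) ≤ e * Q.card := by
        calc _ ≤ ∑ w ∈ Q, e := Finset.sum_le_sum fun w hw => (hbig w hw).le
          _ = e * Q.card := by rw [Finset.sum_const, nsmul_eq_mul, mul_comm]
      have h4 : ∑ w ∈ Q, (clN G w Q).card ≤ 2 * ∑ w ∈ Q, (out w).card := by
        calc _ ≤ ∑ w ∈ Q, ((out w).card + (Q.filter (fun u => w ∈ out u)).card) :=
              Finset.sum_le_sum h1
          _ = _ := by rw [Finset.sum_add_distrib, h2, two_mul]
      have h5 : ∑ w ∈ Q, ((clN G w Q).card : ℝ) ≤ 2 * ∑ w ∈ Q, ((out w).card : ℝ) := by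
        exact_mod_cast h4
      linarith
    refine ⟨Q.filter (fun w => ((clN G w Q).card : ℝ) ≤ 4 * e), Finset.filter_subset _ _, ?_,
      fun w hw => (Finset.mem_filter.1 hw).2⟩
    have h1 := Finset.card_filter_add_card_filter_not
      (s := Q) (fun w => ((clN G w Q).card : ℝ) ≤ 4 * e)
    have h2 : ((Q.filter (fun w => ¬ ((clN G w Q).card : ℝ) ≤ 4 * e)).card : ℝ) * (4 * e) ≤
        2 * (e * Q.card) := by
      refine le_trans ?_ hsum
      calc _ = ∑ w ∈ Q.filter (fun w => ¬ ((clN G w Q).card : ℝ) ≤ 4 * e), 4 * e := by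
            rw [Finset.sum_const, nsmul_eq_mul]
        _ ≤ ∑ w ∈ Q.filter (fun w => ¬ ((clN G w Q).card : ℝ) ≤ 4 * e), ((clN G w Q).card : ℝ) :=
            Finset.sum_le_sum fun w hw => (not_le.1 (Finset.mem_filter.1 hw).2).le
        _ ≤ _ := Finset.sum_le_sum_of_subset_of_nonneg (Finset.filter_subset _ _)
            fun _ _ _ => by positivity
    have h3 : (2 : ℝ) * ((Q.filter (fun w => ¬ ((clN G w Q).card : ℝ) ≤ 4 * e)).card : ℝ) ≤
        Q.card := by
      by_contra hc
      rw [not_le] at hc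
      nlinarith
    have h4 : 2 * (Q.filter (fun w => ¬ ((clN G w Q).card : ℝ) ≤ 4 * e)).card ≤ Q.card := by
      exact_mod_cast h3
    omega

end Nest

section Components
variable {V : Type*}

/-- No partition of `X` into two nonempty parts is anticomplete in `H`. -/
def NoCut (H : SimpleGraph V) (X : Finset V) : Prop :=
  ∀ Y ⊆ X, Y.Nonempty → (X \ Y).Nonempty → ∃ a ∈ Y, ∃ b ∈ X \ Y, H.Adj a b

theorem exists_large_component (H : SimpleGraph V) (K : Finset V) {m : ℝ}
    (hK : 3 * m ≤ K.card) (hm : 0 < m)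
    (h : ∀ X ⊆ K, ∀ Y ⊆ K, Disjoint X Y → AnticompletePair H X Y →
      (X.card : ℝ) < m ∨ (Y.card : ℝ) < m) :
    ∃ X ⊆ K, ((K \ X).card : ℝ) < m ∧ AnticompletePair H X (K \ X) ∧ NoCut H X := by
  obtain ⟨X, hX, hmin⟩ := Finset.exists_min_image
    (K.powerset.filter (fun X => AnticompletePair H X (K \ X) ∧ ((K \ X).card : ℝ) < m))
    Finset.card ⟨K, by
      simp only [Finset.mem_filter, Finset.mem_powerset, Finset.sdiff_self, Finset.card_empty]
      exact ⟨subset_rfl, fun a _ b hb => absurd hb (Finset.notMem_empty b), by simpa using hm⟩⟩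
  simp only [Finset.mem_filter, Finset.mem_powerset] at hX hmin
  obtain ⟨hXK, hanti, hXm⟩ := hX
  refine ⟨X, hXK, hXm, hanti, fun Y hYX hY hXY => ?_⟩
  by_contra! hno
  have a1 : AnticompletePair H Y (K \ Y) := by
    intro a ha b hb
    rw [Finset.mem_sdiff] at hb
    by_cases hbX : b ∈ X
    · exact hno a ha b (Finset.mem_sdiff.2 ⟨hbX, hb.2⟩)
    · exact hanti a (hYX ha) b (Finset.mem_sdiff.2 ⟨hb.1, hbX⟩)
  have a2 : AnticompletePair H (X \ Y) (K \ (X \ Y)) := by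
    intro a ha b hb
    have ha' := Finset.mem_sdiff.1 ha
    rw [Finset.mem_sdiff, Finset.mem_sdiff] at hb
    by_cases hbX : b ∈ X
    · have hbY : b ∈ Y := by by_contra hc; exact hb.2 ⟨hbX, hc⟩
      exact fun e => hno b hbY a ha e.symm
    · exact hanti a ha'.1 b (Finset.mem_sdiff.2 ⟨hb.1, hbX⟩)
  have c1 : (Y.card : ℝ) < m := by
    by_contra! hc
    rcases h Y (hYX.trans hXK) (K \ Y) Finset.sdiff_subset Finset.disjoint_sdiff a1 with h1 | h1
    · linarith
    · have h2 := hmin Y ⟨hYX.trans hXK, a1, h1⟩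
      have h3 := Finset.card_sdiff_add_card_eq_card hYX
      have := Finset.card_pos.2 hXY
      omega
  have c2 : ((X \ Y).card : ℝ) < m := by
    by_contra! hc
    rcases h (X \ Y) (Finset.sdiff_subset.trans hXK) (K \ (X \ Y)) Finset.sdiff_subset
      Finset.disjoint_sdiff a2 with h1 | h1
    · linarith
    · have h2 := hmin (X \ Y) ⟨Finset.sdiff_subset.trans hXK, a2, h1⟩
      have h3 := Finset.card_sdiff_add_card_eq_card hYX
      have := Finset.card_pos.2 hY
      omega
  have h3 : ((X \ Y).card : ℝ) + Y.card = X.card := by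
    exact_mod_cast Finset.card_sdiff_add_card_eq_card hYX
  have h4 : ((K \ X).card : ℝ) + X.card = K.card := by
    exact_mod_cast Finset.card_sdiff_add_card_eq_card hXK
  linarith

theorem exists_next_component (H : SimpleGraph V) {C F : Finset V} {m : ℝ}
    (hC : NoCut H C) (hF : F ⊆ C) (hF0 : F.Nonempty) (hm : 0 < m)
    (hcard : 3 * m + F.card ≤ C.card)
    (h : ∀ X ⊆ C, ∀ Y ⊆ C, Disjoint X Y → AnticompletePair H X Y →
      (X.card : ℝ) < m ∨ (Y.card : ℝ) < m) :
    ∃ D ⊆ C \ F, NoCut H D ∧ (C.card : ℝ) - F.card - m < D.card ∧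
      ∃ u ∈ F, ∃ x ∈ D, H.Adj u x := by
  have h1 : ((C \ F).card : ℝ) + F.card = C.card := by
    exact_mod_cast Finset.card_sdiff_add_card_eq_card hF
  obtain ⟨X, hX, hXm, hanti, hcut⟩ := exists_large_component H (C \ F) (m := m) (by linarith) hm
    (fun X hX Y hY => h X (hX.trans Finset.sdiff_subset) Y (hY.trans Finset.sdiff_subset))
  have h2 : (((C \ F) \ X).card : ℝ) + X.card = (C \ F).card := by
    exact_mod_cast Finset.card_sdiff_add_card_eq_card hX
  have hXpos : X.Nonempty := by
    rw [← Finset.card_pos]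
    have : (0 : ℝ) < X.card := by linarith
    exact_mod_cast this
  refine ⟨X, hX, hcut, by linarith, ?_⟩
  obtain ⟨f, hf⟩ := hF0
  obtain ⟨a, ha, b, hb, hab⟩ := hC X (hX.trans Finset.sdiff_subset) hXpos
    ⟨f, Finset.mem_sdiff.2 ⟨hF hf, fun hfX => (Finset.mem_sdiff.1 (hX hfX)).2 hf⟩⟩
  rw [Finset.mem_sdiff] at hb
  refine ⟨b, ?_, a, ha, hab.symm⟩
  by_contra hbF
  exact hanti a ha b (Finset.mem_sdiff.2 ⟨Finset.mem_sdiff.2 ⟨hb.1, hbF⟩, hb.2⟩) hab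

/-- A very dense house-free graph contains a complete pair of linear size. -/
theorem HouseFree.exists_complete_pair {G : SimpleGraph V} (hG : HouseFree G) {Q : Finset V}
    (hQ : Q.Nonempty) (hdeg : ∀ w ∈ Q, ((clN Gᶜ w Q).card : ℝ) ≤ Q.card / 100) :
    ∃ X ⊆ Q, ∃ Y ⊆ Q, Disjoint X Y ∧ AnticompletePair Gᶜ X Y ∧
      (Q.card : ℝ) / 20 ≤ X.card ∧ (Q.card : ℝ) / 20 ≤ Y.card := by
  by_contra! hcon
  have hq : (0 : ℝ) < Q.card := by exact_mod_cast Finset.card_pos.2 hQ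
  set m : ℝ := Q.card / 20 with hm
  have hm0 : 0 < m := by positivity
  have hpair : ∀ X ⊆ Q, ∀ Y ⊆ Q, Disjoint X Y → AnticompletePair Gᶜ X Y →
      (X.card : ℝ) < m ∨ (Y.card : ℝ) < m := by
    intro X hX Y hY hd ha
    by_contra! hc
    have := hcon X hX Y hY hd ha hc.1
    linarith [hc.2]
  have hN : ∀ w ∈ Q, ∀ C ⊆ Q, ((C.filter (Gᶜ.Adj w)).card : ℝ) ≤ Q.card / 100 := by
    intro w hw C hC
    refine le_trans ?_ (hdeg w hw)
    have : C.filter (Gᶜ.Adj w) ⊆ clN Gᶜ w Q := fun u hu =>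
      mem_clN.2 ⟨hC (Finset.mem_filter.1 hu).1, Or.inr (Finset.mem_filter.1 hu).2⟩
    exact_mod_cast Finset.card_le_card this
  obtain ⟨C1, hC1, hc1, -, hcut1⟩ := exists_large_component Gᶜ Q (m := m) (by linarith) hm0 hpair
  have h1 : ((Q \ C1).card : ℝ) + C1.card = Q.card := by
    exact_mod_cast Finset.card_sdiff_add_card_eq_card hC1
  obtain ⟨v1, hv1⟩ : C1.Nonempty := by
    rw [← Finset.card_pos]
    have : (0 : ℝ) < C1.card := by linarith
    exact_mod_cast this
  have hF1 : ((clN Gᶜ v1 C1).card : ℝ) ≤ Q.card / 100 := by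
    refine le_trans ?_ (hdeg v1 (hC1 hv1))
    exact_mod_cast Finset.card_le_card (clN_mono hC1)
  obtain ⟨C2, hC2, hcut2, hc2, v2, hv2, x2, hx2, hvx2⟩ := exists_next_component Gᶜ hcut1
    clN_subset ⟨v1, self_mem_clN hv1⟩ hm0 (by linarith)
    (fun X hX Y hY => hpair X (hX.trans hC1) Y (hY.trans hC1))
  have hC2Q : C2 ⊆ Q := hC2.trans (Finset.sdiff_subset.trans hC1)
  have n1 : ∀ x ∈ C2, G.Adj v1 x := by
    intro x hx
    obtain ⟨hx1, hx2⟩ := Finset.mem_sdiff.1 (hC2 hx)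
    by_contra hn
    refine hx2 (mem_clN.2 ⟨hx1, ?_⟩)
    by_cases e : x = v1
    · exact Or.inl e
    · exact Or.inr ⟨fun e' => e e'.symm, hn⟩
  obtain ⟨hv2C, hv2'⟩ := mem_clN.1 hv2
  have h12 : Gᶜ.Adj v1 v2 := by
    rcases hv2' with rfl | h
    · exact absurd (n1 x2 hx2) hvx2.2
    · exact h
  have hv2Q := hC1 hv2C
  have hF2 := hN v2 hv2Q C2 hC2Q
  obtain ⟨C3, hC3, hcut3, hc3, v3, hv3, x3, hx3, hvx3⟩ := exists_next_component Gᶜ hcut2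
    (Finset.filter_subset (Gᶜ.Adj v2) C2) ⟨x2, Finset.mem_filter.2 ⟨hx2, hvx2⟩⟩ hm0
    (by linarith) (fun X hX Y hY => hpair X (hX.trans hC2Q) Y (hY.trans hC2Q))
  obtain ⟨hv3C, h23⟩ := Finset.mem_filter.1 hv3
  have hC32 : C3 ⊆ C2 := hC3.trans Finset.sdiff_subset
  have hC3Q : C3 ⊆ Q := hC32.trans hC2Q
  have n2 : ∀ x ∈ C3, x ≠ v2 → G.Adj v2 x := by
    intro x hx hne
    obtain ⟨hx1, hx2⟩ := Finset.mem_sdiff.1 (hC3 hx)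
    by_contra hn
    exact hx2 (Finset.mem_filter.2 ⟨hx1, fun e => hne e.symm, hn⟩)
  have hv2not : v2 ∉ C2 := fun h => (h12.2 (n1 v2 h))
  have n2' : ∀ x ∈ C3, G.Adj v2 x := fun x hx => n2 x hx fun e => hv2not (e ▸ hC32 hx)
  have hF3 := hN v3 (hC2Q hv3C) C3 hC3Q
  obtain ⟨C4, hC4, hcut4, hc4, v4, hv4, v5, hv5, h45⟩ := exists_next_component Gᶜ hcut3
    (Finset.filter_subset (Gᶜ.Adj v3) C3) ⟨x3, Finset.mem_filter.2 ⟨hx3, hvx3⟩⟩ hm0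
    (by linarith) (fun X hX Y hY => hpair X (hX.trans hC3Q) Y (hY.trans hC3Q))
  obtain ⟨hv4C, h34⟩ := Finset.mem_filter.1 hv4
  obtain ⟨hv5C, hv5n⟩ := Finset.mem_sdiff.1 (hC4 hv5)
  have hv3not : v3 ∉ C3 := fun h => (Finset.mem_sdiff.1 (hC3 h)).2 (Finset.mem_filter.2 ⟨hv3C, h23⟩)
  have h35 : G.Adj v3 v5 := by
    by_contra hn
    exact hv5n (Finset.mem_filter.2 ⟨hv5C, fun e => hv3not (e ▸ hv5C), hn⟩)
  exact hG.no_path h12 h23 h34 h45 (n1 v3 hv3C) (n1 v4 (hC32 hv4C)) (n1 v5 (hC32 hv5C))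
    (n2' v4 hv4C) (n2' v5 hv5C) h35

theorem Blockade.sum {H : SimpleGraph V} {U X Y : Finset V} {k l : ℕ} {w : ℝ}
    (hX : X ⊆ U) (hY : Y ⊆ U) (hd : Disjoint X Y) (ha : AnticompletePair H X Y)
    (h1 : Blockade H X k w) (h2 : Blockade H Y l w) : Blockade H U (k + l) w := by
  obtain ⟨ι, _, A, hA, hA1, hA2⟩ := h1
  obtain ⟨κ, _, B, hB, hB1, hB2⟩ := h2
  refine ⟨ι ⊕ κ, inferInstance, Sum.elim A B, by rw [Fintype.card_sum, hA, hB], ?_, ?_⟩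
  · rintro (i | i)
    · exact ⟨(hA1 i).1.trans hX, (hA1 i).2⟩
    · exact ⟨(hB1 i).1.trans hY, (hB1 i).2⟩
  · rintro (i | i) (j | j) hij
    · exact hA2 i j fun e => hij (by rw [e])
    · exact ⟨hd.mono (hA1 i).1 (hB1 j).1, fun a h b h' => ha a ((hA1 i).1 h) b ((hB1 j).1 h')⟩
    · exact ⟨(hd.mono (hA1 j).1 (hB1 i).1).symm,
        fun a h b h' e => ha b ((hA1 j).1 h') a ((hB1 i).1 h) e.symm⟩
    · exact hB2 i j fun e => hij (by rw [e])

theorem Blockade.mono {H : SimpleGraph V} {U U' : Finset V} {k : ℕ} {w w' : ℝ}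
    (h : Blockade H U k w) (hU : U ⊆ U') (hw : w' ≤ w) : Blockade H U' k w' := by
  obtain ⟨ι, _, A, hA, hA1, hA2⟩ := h
  exact ⟨ι, _, A, hA, fun i => ⟨(hA1 i).1.trans hU, hw.trans (hA1 i).2⟩, hA2⟩

theorem HouseFree.blockade_of_dense {G : SimpleGraph V} (hG : HouseFree G) {e : ℝ} (he : 0 < e)
    (j : ℕ) : ∀ Q : Finset V, (∀ w ∈ Q, ((clN Gᶜ w Q).card : ℝ) ≤ e) →
      100 * 20 ^ j * e ≤ Q.card → Blockade Gᶜ Q (2 ^ j) (Q.card / 20 ^ j) := by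
  induction j with
  | zero =>
    intro Q _ _
    refine ⟨Unit, inferInstance, fun _ => Q, by simp, fun _ => ⟨subset_rfl, by simp⟩, ?_⟩
    intro i j h
    exact absurd (Subsingleton.elim i j) h
  | succ j ih =>
    intro Q hdeg hQ
    have hp : (1 : ℝ) ≤ 20 ^ j := one_le_pow₀ (by norm_num)
    rw [pow_succ] at hQ
    have hq : (0 : ℝ) < Q.card := lt_of_lt_of_le (by positivity) hQ
    obtain ⟨X, hX, Y, hY, hd, ha, hXc, hYc⟩ := hG.exists_complete_pair
      (Finset.card_pos.1 (by exact_mod_cast hq)) (fun w hw => (hdeg w hw).trans (by nlinarith))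
    have sub : ∀ Z ⊆ Q, (Q.card : ℝ) / 20 ≤ Z.card →
        Blockade Gᶜ Z (2 ^ j) (Q.card / 20 ^ (j + 1)) := by
      intro Z hZ hZc
      refine (ih Z (fun w hw => ?_) (by linarith)).mono subset_rfl ?_
      · refine le_trans ?_ (hdeg w (hZ hw))
        exact_mod_cast Finset.card_le_card (clN_mono hZ)
      · rw [pow_succ, mul_comm, ← div_div]
        gcongr
    have := Blockade.sum hX hY hd ha (sub X hX hXc) (sub Y hY hYc)
    rwa [← two_mul, ← pow_succ'] at this

end Components

section Start
variable {V : Type*} {G : SimpleGraph V}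

/-- Every pure pair of disjoint subsets of `U` has a part smaller than `m`. -/
def NoPurePair (G : SimpleGraph V) (U : Finset V) (m : ℝ) : Prop :=
  (∀ X ⊆ U, ∀ Y ⊆ U, Disjoint X Y → AnticompletePair G X Y → (X.card : ℝ) < m ∨ (Y.card : ℝ) < m) ∧
  (∀ X ⊆ U, ∀ Y ⊆ U, Disjoint X Y → AnticompletePair Gᶜ X Y →
    (X.card : ℝ) < m ∨ (Y.card : ℝ) < m)

theorem HouseFree.common_nbrs_small_or_large (hG : HouseFree G) {U P : Finset V} {m : ℝ}
    (hm : 0 < m) (hU : NoPurePair G U m) (hPU : P ⊆ U) {v b : V} (hP : ∀ p ∈ P, G.Adj v p)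
    (hbv : ¬ G.Adj b v) :
    ((P.filter (G.Adj b)).card : ℝ) < 3 * m ∨
      ((P.filter (fun p => ¬ G.Adj b p)).card : ℝ) < 2 * m := by
  by_contra! hcon
  obtain ⟨h1, h2⟩ := hcon
  set K := P.filter (G.Adj b) with hK
  have hKU : K ⊆ U := (Finset.filter_subset _ _).trans hPU
  obtain ⟨X, hX, hXm, -, hcut⟩ := exists_large_component Gᶜ K h1 hm
    (fun X hX Y hY => hU.2 X (hX.trans hKU) Y (hY.trans hKU))
  have hXc : m ≤ X.card := by
    have : ((K \ X).card : ℝ) + X.card = K.card := by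
      exact_mod_cast Finset.card_sdiff_add_card_eq_card hX
    linarith
  set W := P.filter (fun p => ¬ G.Adj b p) with hW
  have hWU : W ⊆ U := (Finset.filter_subset _ _).trans hPU
  have hpure : ∀ w ∈ W, (∀ x ∈ X, G.Adj w x) ∨ (∀ x ∈ X, ¬ G.Adj w x) := by
    intro w hw
    by_contra! hc
    obtain ⟨⟨y, hy, hwy⟩, ⟨x, hx, hwx⟩⟩ := hc
    obtain ⟨a, ha, c, hc, hac⟩ := hcut (X.filter (G.Adj w)) (Finset.filter_subset _ _)
      ⟨x, Finset.mem_filter.2 ⟨hx, hwx⟩⟩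
      ⟨y, Finset.mem_sdiff.2 ⟨hy, fun h => hwy (Finset.mem_filter.1 h).2⟩⟩
    obtain ⟨ha1, ha2⟩ := Finset.mem_filter.1 ha
    obtain ⟨hc1, hc2⟩ := Finset.mem_sdiff.1 hc
    have ha3 := Finset.mem_filter.1 (hX ha1)
    have hc3 := Finset.mem_filter.1 (hX hc1)
    have hw3 := Finset.mem_filter.1 hw
    exact hG.no_mixed (hP a ha3.1) (hP c hc3.1) (hP w hw3.1) hbv ha3.2 hc3.2 hac.2 ha2
      (fun h => hc2 (Finset.mem_filter.2 ⟨hc1, h⟩)) hw3.2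
  have hdisj : Disjoint W X := by
    rw [Finset.disjoint_left]
    exact fun w hw hx => (Finset.mem_filter.1 hw).2 (Finset.mem_filter.1 (hX hx)).2
  have c1 : ((W.filter (fun w => ∀ x ∈ X, G.Adj w x)).card : ℝ) < m := by
    refine (hU.2 _ ((Finset.filter_subset _ _).trans hWU) X (hX.trans hKU)
      (hdisj.mono_left (Finset.filter_subset _ _)) ?_).resolve_right (not_lt.2 hXc)
    exact fun w hw x hx h => h.2 ((Finset.mem_filter.1 hw).2 x hx)
  have c2 : ((W.filter (fun w => ¬ ∀ x ∈ X, G.Adj w x)).card : ℝ) < m := by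
    refine (hU.1 _ ((Finset.filter_subset _ _).trans hWU) X (hX.trans hKU)
      (hdisj.mono_left (Finset.filter_subset _ _)) ?_).resolve_right (not_lt.2 hXc)
    intro w hw
    obtain ⟨hw1, hw2⟩ := Finset.mem_filter.1 hw
    exact (hpure w hw1).resolve_left hw2
  have c3 : ((W.filter (fun w => ∀ x ∈ X, G.Adj w x)).card : ℝ) +
      ((W.filter (fun w => ¬ ∀ x ∈ X, G.Adj w x)).card : ℝ) = W.card := by
    exact_mod_cast Finset.card_filter_add_card_filter_not _
  linarith

theorem card_filter_clN_le {Q R : Finset V} {H : SimpleGraph V} {w : V} (h : R ⊆ Q) :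
    ((clN H w R).card : ℝ) ≤ (clN H w Q).card := by
  exact_mod_cast Finset.card_le_card (clN_mono h)

/-- A house-free graph with no linear pure pair has a sparse induced subgraph of linear size. -/
theorem HouseFree.exists_sparse_subset (hG : HouseFree G) {U : Finset V} {m e : ℝ} (hm : 1 ≤ m)
    (hU : NoPurePair G U m) (he : 0 < e) (he1 : e ≤ 1 / 200) (hme : 100 * m ≤ e ^ 2 * U.card) :
    ∃ S ⊆ U, e / 8 * U.card ≤ S.card ∧
      ∀ w ∈ S, ((clN G w S).card : ℝ) ≤ 32 * e * S.card := by
  set N := (U.card : ℝ) with hN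
  have hN0 : 0 ≤ N := by positivity
  have he2 : e ^ 2 * N ≤ e / 200 * N := by
    apply mul_le_mul_of_nonneg_right _ hN0
    nlinarith
  have he3 : e * N ≤ N / 200 := by nlinarith
  have hm0 : 0 < m := by linarith
  have dense : ∀ C ⊆ U, 20 * m ≤ C.card →
      (∀ w ∈ C, ((clN Gᶜ w C).card : ℝ) ≤ C.card / 100) → False := by
    intro C hC hc hd
    have hCn : C.Nonempty := by
      rw [← Finset.card_pos]
      have : (0 : ℝ) < C.card := by linarith
      exact_mod_cast this
    obtain ⟨X, hX, Y, hY, hdis, ha, hXc, hYc⟩ := hG.exists_complete_pair hCn hd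
    rcases hU.2 X (hX.trans hC) Y (hY.trans hC) hdis ha with h | h <;> linarith
  by_cases h1 : N / 2 ≤ ((U.filter (fun w => ((clN G w U).card : ℝ) ≤ e * N)).card : ℝ)
  · refine ⟨U.filter (fun w => ((clN G w U).card : ℝ) ≤ e * N), Finset.filter_subset _ _,
      by nlinarith, fun w hw => ?_⟩
    refine (card_filter_clN_le (Finset.filter_subset _ _)).trans
      ((Finset.mem_filter.1 hw).2.trans ?_)
    nlinarith
  by_cases h2 : N / 2 ≤ ((U.filter (fun w => ((clN Gᶜ w U).card : ℝ) ≤ e * N)).card : ℝ)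
  · exfalso
    refine dense _ (Finset.filter_subset _ _) (by linarith) fun w hw => ?_
    refine (card_filter_clN_le (Finset.filter_subset _ _)).trans
      ((Finset.mem_filter.1 hw).2.trans ?_)
    linarith
  obtain ⟨v, hvU, hv1, hv2⟩ : ∃ v ∈ U, e * N < ((clN G v U).card : ℝ) ∧
      e * N < ((clN Gᶜ v U).card : ℝ) := by
    by_contra! hc
    have hsub : U ⊆ U.filter (fun w => ((clN G w U).card : ℝ) ≤ e * N) ∪
        U.filter (fun w => ((clN Gᶜ w U).card : ℝ) ≤ e * N) := by
      intro w hw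
      rw [Finset.mem_union, Finset.mem_filter, Finset.mem_filter]
      by_cases h : ((clN G w U).card : ℝ) ≤ e * N
      · exact Or.inl ⟨hw, h⟩
      · exact Or.inr ⟨hw, hc w hw (not_le.1 h)⟩
    have h3 := (Finset.card_le_card hsub).trans (Finset.card_union_le _ _)
    have h4 : N ≤ ((U.filter (fun w => ((clN G w U).card : ℝ) ≤ e * N)).card : ℝ) +
        ((U.filter (fun w => ((clN Gᶜ w U).card : ℝ) ≤ e * N)).card : ℝ) := by
      rw [hN]
      exact_mod_cast h3
    linarith
  set P := U.filter (G.Adj v) with hP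
  set B := U.filter (fun b => ¬ G.Adj b v) with hB
  have hPv : ∀ p ∈ P, G.Adj v p := fun p hp => (Finset.mem_filter.1 hp).2
  have hPU : P ⊆ U := Finset.filter_subset _ _
  have hBU : B ⊆ U := Finset.filter_subset _ _
  have hPc : e * N / 2 ≤ P.card := by
    have : clN G v U ⊆ insert v P := by
      intro u hu
      obtain ⟨h1, h2⟩ := mem_clN.1 hu
      rw [Finset.mem_insert, Finset.mem_filter]
      tauto
    have h3 := (Finset.card_le_card this).trans (Finset.card_insert_le _ _)
    have h4 : ((clN G v U).card : ℝ) ≤ P.card + 1 := by exact_mod_cast h3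
    linarith
  have hBc : e * N ≤ B.card := by
    have : clN Gᶜ v U ⊆ B := by
      intro u hu
      obtain ⟨h1, h2⟩ := mem_clN.1 hu
      refine Finset.mem_filter.2 ⟨h1, ?_⟩
      rcases h2 with rfl | h2
      · exact G.irrefl
      · exact fun h => h2.2 h.symm
    have h4 : ((clN Gᶜ v U).card : ℝ) ≤ B.card := by exact_mod_cast Finset.card_le_card this
    linarith
  set Be := B.filter (fun b => ((P.filter (fun p => ¬ G.Adj b p)).card : ℝ) < 2 * m) with hBe
  set Bd := B.filter (fun b => ((P.filter (G.Adj b)).card : ℝ) < 3 * m) with hBd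
  have hBsplit : (B.card : ℝ) ≤ Be.card + Bd.card := by
    have hsub : B ⊆ Be ∪ Bd := by
      intro b hb
      rcases hG.common_nbrs_small_or_large hm0 hU hPU hPv (Finset.mem_filter.1 hb).2 with h | h
      · exact Finset.mem_union_right _ (Finset.mem_filter.2 ⟨hb, h⟩)
      · exact Finset.mem_union_left _ (Finset.mem_filter.2 ⟨hb, h⟩)
    exact_mod_cast (Finset.card_le_card hsub).trans (Finset.card_union_le _ _)
  by_cases hBe1 : e * N / 2 ≤ Be.card
  · refine ⟨Be, (Finset.filter_subset _ _).trans hBU, by linarith, fun b hb => ?_⟩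
    obtain ⟨hbB, hb2⟩ := Finset.mem_filter.1 hb
    obtain ⟨hbU, hbv⟩ := Finset.mem_filter.1 hbB
    have hK : ((P.filter (G.Adj b)).card : ℝ) + ((P.filter (fun p => ¬ G.Adj b p)).card : ℝ)
        = P.card := by
      exact_mod_cast Finset.card_filter_add_card_filter_not _
    have hK3 : (((U.filter (G.Adj b)).filter (G.Adj v)).card : ℝ) = (P.filter (G.Adj b)).card := by
      rw [hP, Finset.filter_comm]
    have h3 := (hG.common_nbrs_small_or_large hm0 hU (Finset.filter_subset (G.Adj b) U)
      (fun p hp => (Finset.mem_filter.1 hp).2) (fun h => hbv h.symm)).resolve_left (by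
        rw [hK3]; linarith)
    have hsub : clN G b Be ⊆ insert b ((U.filter (G.Adj b)).filter (fun p => ¬ G.Adj v p)) := by
      intro u hu
      obtain ⟨hu1, hu2⟩ := mem_clN.1 hu
      obtain ⟨huU, huv⟩ := Finset.mem_filter.1 (Finset.mem_filter.1 hu1).1
      rw [Finset.mem_insert, Finset.mem_filter, Finset.mem_filter]
      rcases hu2 with h | h
      · exact Or.inl h
      · exact Or.inr ⟨⟨huU, h⟩, fun h => huv h.symm⟩
    have h4 := (Finset.card_le_card hsub).trans (Finset.card_insert_le _ _)
    have h5 : ((clN G b Be).card : ℝ) ≤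
        ((U.filter (G.Adj b)).filter (fun p => ¬ G.Adj v p)).card + 1 := by exact_mod_cast h4
    have h6 : e * (e * N / 2) ≤ e * Be.card := mul_le_mul_of_nonneg_left hBe1 he.le
    nlinarith
  have hBd1 : e * N / 2 ≤ Bd.card := by linarith
  have hBdpos : (0 : ℝ) < Bd.card := by linarith
  set Ps := P.filter (fun p => ((Bd.filter (G.Adj p)).card : ℝ) ≤ Bd.card / 8) with hPs
  have hPsP : Ps ⊆ P := Finset.filter_subset _ _
  have hPsc : (P.card : ℝ) / 2 ≤ Ps.card := by
    have e1 := Finset.sum_card_bipartiteAbove_eq_sum_card_bipartiteBelow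
      (s := P) (t := Bd) G.Adj
    simp only [Finset.bipartiteAbove, Finset.bipartiteBelow] at e1
    have e2 : ∑ p ∈ P, ((Bd.filter (G.Adj p)).card : ℝ) ≤ Bd.card * (3 * m) := by
      have : ∑ p ∈ P, ((Bd.filter (G.Adj p)).card : ℝ) =
          ∑ b ∈ Bd, ((P.filter (fun p => G.Adj p b)).card : ℝ) := by exact_mod_cast e1
      rw [this]
      calc _ ≤ ∑ b ∈ Bd, 3 * m := by
            refine Finset.sum_le_sum fun b hb => ?_
            have := (Finset.mem_filter.1 hb).2
            simp only [G.adj_comm b] at this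
            exact this.le
        _ = _ := by rw [Finset.sum_const, nsmul_eq_mul]
    have e3 : ((P.filter (fun p => ¬ ((Bd.filter (G.Adj p)).card : ℝ) ≤ Bd.card / 8)).card : ℝ) *
        (Bd.card / 8) ≤ Bd.card * (3 * m) := by
      refine le_trans ?_ e2
      calc _ = ∑ p ∈ P.filter (fun p => ¬ ((Bd.filter (G.Adj p)).card : ℝ) ≤ Bd.card / 8),
            (Bd.card / 8 : ℝ) := by rw [Finset.sum_const, nsmul_eq_mul]
        _ ≤ ∑ p ∈ P.filter (fun p => ¬ ((Bd.filter (G.Adj p)).card : ℝ) ≤ Bd.card / 8),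
            ((Bd.filter (G.Adj p)).card : ℝ) :=
            Finset.sum_le_sum fun p hp => (not_le.1 (Finset.mem_filter.1 hp).2).le
        _ ≤ _ := Finset.sum_le_sum_of_subset_of_nonneg (Finset.filter_subset _ _)
            fun _ _ _ => by positivity
    have e4 : (Ps.card : ℝ) +
        ((P.filter (fun p => ¬ ((Bd.filter (G.Adj p)).card : ℝ) ≤ Bd.card / 8)).card : ℝ)
        = P.card := by
      exact_mod_cast Finset.card_filter_add_card_filter_not _
    have e5 : ((P.filter (fun p => ¬ ((Bd.filter (G.Adj p)).card : ℝ) ≤ Bd.card / 8)).card : ℝ) ≤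
        24 * m := by
      by_contra hc
      rw [not_le] at hc
      nlinarith
    linarith
  have untouched : ∀ X ⊆ Ps, m ≤ X.card →
      ((Bd.filter (fun b => ∀ x ∈ X, ¬ G.Adj x b)).card : ℝ) < m := by
    intro X hX hXc
    refine (hU.1 X (hX.trans (hPsP.trans hPU)) _ ((Finset.filter_subset _ _).trans
      ((Finset.filter_subset _ _).trans hBU)) ?_ ?_).resolve_left (not_lt.2 hXc)
    · rw [Finset.disjoint_left]
      intro x hx hx2
      exact (Finset.mem_filter.1 (Finset.mem_filter.1 (Finset.mem_filter.1 hx2).1).1).2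
        (hPv x (hPsP (hX hx))).symm
    · exact fun x hx b hb => (Finset.mem_filter.1 hb).2 x hx
  have hnest : ∀ w ∈ Ps, ∀ w' ∈ Ps, G.Adj w w' →
      ((Ps.filter (fun u => G.Adj w u ∧ ¬ G.Adj w' u)).card : ℝ) < m ∨
      ((Ps.filter (fun u => G.Adj w' u ∧ ¬ G.Adj w u)).card : ℝ) < m := by
    intro w hw w' hw' hww
    by_contra! hc
    set X := Ps.filter (fun u => G.Adj w u ∧ ¬ G.Adj w' u)
    set X' := Ps.filter (fun u => G.Adj w' u ∧ ¬ G.Adj w u)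
    have hX : X ⊆ Ps := Finset.filter_subset _ _
    have hX' : X' ⊆ Ps := Finset.filter_subset _ _
    have u1 := untouched X hX hc.1
    have u2 := untouched X' hX' hc.2
    have u3 := (Finset.mem_filter.1 hw).2
    have u4 := (Finset.mem_filter.1 hw').2
    obtain ⟨b, hb, hb1⟩ : ∃ b ∈ Bd, b ∉ ((Bd.filter (fun b => ∀ x ∈ X, ¬ G.Adj x b)) ∪
        (Bd.filter (fun b => ∀ x ∈ X', ¬ G.Adj x b))) ∪
        ((Bd.filter (G.Adj w)) ∪ (Bd.filter (G.Adj w'))) := by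
      by_contra! hcov
      have h3 := (Finset.card_le_card hcov).trans ((Finset.card_union_le _ _).trans
        (add_le_add (Finset.card_union_le _ _) (Finset.card_union_le _ _)))
      have h4 : (Bd.card : ℝ) ≤ ((Bd.filter (fun b => ∀ x ∈ X, ¬ G.Adj x b)).card : ℝ) +
        (Bd.filter (fun b => ∀ x ∈ X', ¬ G.Adj x b)).card +
        ((Bd.filter (G.Adj w)).card + (Bd.filter (G.Adj w')).card) := by exact_mod_cast h3
      linarith
    simp only [Finset.mem_union, Finset.mem_filter, not_or, not_and] at hb1
    obtain ⟨⟨b1, b2⟩, b3, b4⟩ := hb1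
    have b1 := b1 hb
    have b2 := b2 hb
    push Not at b1 b2
    obtain ⟨i, hi, hib⟩ := b1
    obtain ⟨i', hi', hib'⟩ := b2
    have hi2 := Finset.mem_filter.1 hi
    have hi2' := Finset.mem_filter.1 hi'
    exact hG.no_crossing (hPv w (hPsP hw)) (hPv i (hPsP (hX hi))) (hPv i' (hPsP (hX' hi')))
      (Finset.mem_filter.1 (Finset.mem_filter.1 hb).1).2 hib.symm hib'.symm
      (fun h => b3 hb h.symm) (fun h => b4 hb h.symm) hww hi2.2.1.symm
      (fun h => hi2.2.2 h.symm) hi2'.2.1.symm (fun h => hi2'.2.2 h.symm)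
  rcases nest hm (e := e ^ 2 * N) (by linarith) hnest with ⟨C, hC, hCc, hCd⟩ | ⟨Q, hQ, hQc, hQd⟩
  · exfalso
    exact dense C (hC.trans (hPsP.trans hPU)) (by linarith) fun w hw => by
      have := hCd w hw
      linarith
  · have hQc' : (Ps.card : ℝ) ≤ 2 * Q.card := by exact_mod_cast hQc
    refine ⟨Q, hQ.trans (hPsP.trans hPU), by linarith, fun w hw => ?_⟩
    refine (card_filter_clN_le hQ).trans ((hQd w hw).trans ?_)
    have : e * N / 8 ≤ Q.card := by linarith
    have := mul_le_mul_of_nonneg_left this he.le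
    have e5 : 4 * (e ^ 2 * N) = 32 * (e * (e * N / 8)) := by ring
    rw [e5]
    linarith

end Start

section Core
variable {V : Type*} {G : SimpleGraph V}

/-- The non-neighbours of `v` in `W` that have a neighbour in `X`. -/
noncomputable def touch (G : SimpleGraph V) (W : Finset V) (v : V) (X : Finset V) : Finset V :=
  W.filter (fun b => ¬ G.Adj b v ∧ ∃ x ∈ X, G.Adj b x)

theorem mem_touch {W X : Finset V} {v b : V} :
    b ∈ touch G W v X ↔ b ∈ W ∧ ¬ G.Adj b v ∧ ∃ x ∈ X, G.Adj b x := by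
  simp [touch]

theorem touch_mono {W X Y : Finset V} {v : V} (h : X ⊆ Y) : touch G W v X ⊆ touch G W v Y := by
  intro b hb
  obtain ⟨h1, h2, x, hx, h3⟩ := mem_touch.1 hb
  exact mem_touch.2 ⟨h1, h2, x, h hx, h3⟩

/-- The maximum size of a closed neighbourhood in `H[Q]`. -/
noncomputable def maxClN (H : SimpleGraph V) (Q : Finset V) : ℕ :=
  Q.sup (fun w => (clN H w Q).card)

theorem card_clN_le_maxClN {H : SimpleGraph V} {Q : Finset V} {w : V} (h : w ∈ Q) :
    (clN H w Q).card ≤ maxClN H Q := Finset.le_sup (f := fun w => (clN H w Q).card) h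

theorem maxClN_le {H : SimpleGraph V} {Q : Finset V} {x : ℝ} (hx : 0 ≤ x)
    (h : ∀ w ∈ Q, ((clN H w Q).card : ℝ) ≤ x) : (maxClN H Q : ℝ) ≤ x := by
  have : maxClN H Q ≤ ⌊x⌋₊ := Finset.sup_le fun w hw => Nat.le_floor (h w hw)
  exact (Nat.cast_le.2 this).trans (Nat.floor_le hx)

/-- Large subsets of `P` touch proportionally many vertices. -/
def TouchLarge (G : SimpleGraph V) (W : Finset V) (v : V) (P : Finset V) (c : ℝ) : Prop :=
  ∀ X ⊆ P, c * P.card ≤ X.card →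
    (X.card : ℝ) * ((touch G W v P).card : ℝ) ^ 100 ≤
      ((touch G W v X).card : ℝ) ^ 100 * P.card

theorem mul_le_of_pow_bound {n : ℕ} (hn : n ≠ 0) {a p t s d x : ℝ} (hp : 0 < p) (ht : 0 ≤ t)
    (hs : 0 ≤ s) (h : a * t ^ n ≤ s ^ n * p) (hd : d * p ≤ a) (hx : x ^ n ≤ d) : x * t ≤ s := by
  have ht0 : 0 ≤ t ^ n := by positivity
  have h2 : (x * t) ^ n * p ≤ s ^ n * p := by
    refine le_trans ?_ h
    rw [mul_pow]
    calc x ^ n * t ^ n * p ≤ d * t ^ n * p := by gcongr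
      _ = (d * p) * t ^ n := by ring
      _ ≤ a * t ^ n := by gcongr
  exact le_of_pow_le_pow_left₀ hn hs (le_of_mul_le_mul_right h2 hp)

theorem TouchLarge.le {W P X : Finset V} {v : V} {c d x : ℝ} (h : TouchLarge G W v P c)
    (hX : X ⊆ P) (hP : P.Nonempty) (hcd : c ≤ d) (hd : d * P.card ≤ X.card)
    (hxd : x ^ 100 ≤ d) :
    x * (touch G W v P).card ≤ (touch G W v X).card := by
  have hp : (0 : ℝ) < P.card := by exact_mod_cast Finset.card_pos.2 hP
  have h1 := h X hX ((mul_le_mul_of_nonneg_right hcd hp.le).trans hd)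
  exact mul_le_of_pow_bound (by norm_num) hp (by positivity) (by positivity) h1 hd hxd

/-- Neighbourhoods of adjacent vertices in `P` are nearly nested. -/
theorem HouseFree.nearly_nested (hG : HouseFree G) {W P : Finset V} {v : V} {c q : ℝ}
    (hP : ∀ p ∈ P, G.Adj v p) (hT : TouchLarge G W v P c) (hc : c ≤ 1 / 2 ^ 37)
    (ht : 0 < (touch G W v P).card) (hq : q ≤ 1 / 2 ^ 10)
    (hdeg : ∀ p ∈ P, ((W.filter (G.Adj p)).card : ℝ) ≤ 2 * q * (touch G W v P).card) :
    ∀ w ∈ P, ∀ w' ∈ P, G.Adj w w' →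
      ((P.filter (fun u => G.Adj w u ∧ ¬ G.Adj w' u)).card : ℝ) < 1 / 2 ^ 37 * P.card ∨
      ((P.filter (fun u => G.Adj w' u ∧ ¬ G.Adj w u)).card : ℝ) < 1 / 2 ^ 37 * P.card := by
  intro w hw w' hw' hww
  by_contra! hcon
  set X := P.filter (fun u => G.Adj w u ∧ ¬ G.Adj w' u)
  set X' := P.filter (fun u => G.Adj w' u ∧ ¬ G.Adj w u)
  have hX : X ⊆ P := Finset.filter_subset _ _
  have hX' : X' ⊆ P := Finset.filter_subset _ _
  have t1 := hT.le (x := 3 / 4) hX ⟨w, hw⟩ hc hcon.1 (by norm_num)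
  have t2 := hT.le (x := 3 / 4) hX' ⟨w, hw⟩ hc hcon.2 (by norm_num)
  have hsub : touch G W v X ∩ touch G W v X' ⊆ W.filter (G.Adj w) ∪ W.filter (G.Adj w') := by
    intro b hb
    obtain ⟨hb1, hb2⟩ := Finset.mem_inter.1 hb
    obtain ⟨hbW, hbv, i, hi, hbi⟩ := mem_touch.1 hb1
    obtain ⟨-, -, i', hi', hbi'⟩ := mem_touch.1 hb2
    by_contra hn
    simp only [Finset.mem_union, Finset.mem_filter, not_or, not_and] at hn
    have hi2 := Finset.mem_filter.1 hi
    have hi2' := Finset.mem_filter.1 hi'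
    exact hG.no_crossing (hP w hw) (hP i hi2.1) (hP i' hi2'.1) hbv hbi hbi'
      (fun h => hn.1 hbW h.symm) (fun h => hn.2 hbW h.symm) hww hi2.2.1.symm
      (fun h => hi2.2.2 h.symm) hi2'.2.1.symm (fun h => hi2'.2.2 h.symm)
  have h1 := (Finset.card_le_card hsub).trans (Finset.card_union_le _ _)
  have h2 : ((touch G W v X ∩ touch G W v X').card : ℝ) ≤
      (W.filter (G.Adj w)).card + (W.filter (G.Adj w')).card := by exact_mod_cast h1
  have h3 := Finset.card_union_add_card_inter (touch G W v X) (touch G W v X')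
  have h4 : (touch G W v X ∪ touch G W v X').card ≤ (touch G W v P).card :=
    Finset.card_le_card (Finset.union_subset (touch_mono hX) (touch_mono hX'))
  have h3' : ((touch G W v X ∪ touch G W v X').card : ℝ) +
      (touch G W v X ∩ touch G W v X').card = (touch G W v X).card + (touch G W v X').card := by
    exact_mod_cast h3
  have h4' : ((touch G W v X ∪ touch G W v X').card : ℝ) ≤ (touch G W v P).card := by
    exact_mod_cast h4
  have h5 := hdeg w hw
  have h6 := hdeg w' hw'
  have ht' : (0 : ℝ) < (touch G W v P).card := by exact_mod_cast ht
  nlinarith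

/-- Hence `P` contains a large subset that is very sparse in `G` or in its complement. -/
theorem HouseFree.exists_restricted (hG : HouseFree G) {W P : Finset V} {v : V} {c q : ℝ}
    (hP : ∀ p ∈ P, G.Adj v p) (hT : TouchLarge G W v P c) (hc : c ≤ 1 / 2 ^ 37)
    (ht : 0 < (touch G W v P).card) (hq : q ≤ 1 / 2 ^ 10) (hPc : 2 ^ 37 ≤ (P.card : ℝ))
    (hdeg : ∀ p ∈ P, ((W.filter (G.Adj p)).card : ℝ) ≤ 2 * q * (touch G W v P).card) :
    ∃ H, (H = G ∨ H = Gᶜ) ∧ ∃ Q ⊆ P, 1 / 2 ^ 20 * (P.card : ℝ) ≤ Q.card ∧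
      ∀ w ∈ Q, ((clN H w Q).card : ℝ) ≤ 1 / 2 ^ 16 * Q.card := by
  rcases nest (Q := P) (m := 1 / 2 ^ 37 * P.card) (e := 1 / 2 ^ 20 * P.card)
    (by linarith) (by linarith) (hG.nearly_nested hP hT hc ht hq hdeg) with
    ⟨C, hC, hCc, hCd⟩ | ⟨Q, hQ, hQc, hQd⟩
  · refine ⟨Gᶜ, Or.inr rfl, C, hC, hCc, fun w hw => ?_⟩
    have := hCd w hw
    linarith
  · have hQc' : (P.card : ℝ) ≤ 2 * Q.card := by exact_mod_cast hQc
    refine ⟨G, Or.inl rfl, Q, hQ, by linarith, fun w hw => ?_⟩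
    have := (card_filter_clN_le hQ).trans (hQd w hw)
    linarith

/-- Combs in `G` or its complement, seen from a common non-neighbour `b` of the blocks, have
pairwise anticomplete blocks, and their apexes cross. -/
theorem HouseFree.comb_anticomplete (hG : HouseFree G) {H : SimpleGraph V} (hH : H = G ∨ H = Gᶜ)
    {v b i i' w w' : V} (hbv : ¬ G.Adj b v) (hvi : G.Adj v i) (hvi' : G.Adj v i')
    (hvw : G.Adj v w) (hbi : G.Adj b i) (hbi' : G.Adj b i')
    (hbw : ¬ G.Adj b w) (hbw' : ¬ G.Adj b w') (hiw : H.Adj i w) (hi'w' : H.Adj i' w')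
    (hiw' : ¬ H.Adj i w') (hi'w : ¬ H.Adj i' w) :
    ¬ G.Adj w w' ∧ ((G.Adj i w ∧ ¬ G.Adj i w' ∧ G.Adj i' w' ∧ ¬ G.Adj i' w) ∨
      (G.Adj i' w ∧ ¬ G.Adj i' w' ∧ G.Adj i w' ∧ ¬ G.Adj i w)) := by
  rcases hH with rfl | rfl
  · exact ⟨fun h => hG.no_crossing hvw hvi hvi' hbv hbi hbi' hbw hbw' h hiw hiw' hi'w' hi'w,
      Or.inl ⟨hiw, hiw', hi'w', hi'w⟩⟩
  · have h1 : G.Adj i' w := by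
      by_contra hc
      exact hi'w ⟨fun e => hbw (e ▸ hbi'), hc⟩
    have h2 : G.Adj i w' := by
      by_contra hc
      exact hiw' ⟨fun e => hbw' (e ▸ hbi), hc⟩
    exact ⟨fun h => hG.no_crossing hvw hvi' hvi hbv hbi' hbi hbw hbw' h h1 hi'w'.2 h2 hiw.2,
      Or.inr ⟨h1, hi'w'.2, h2, hiw.2⟩⟩

/-- A wide anticomplete blockade in `P` all of whose pieces touch many vertices cannot exist. -/
theorem HouseFree.no_touching_comb (hG : HouseFree G) {W P : Finset V} {v : V}
    {q : ℝ} (hP : ∀ p ∈ P, G.Adj v p) (ht : 0 < (touch G W v P).card)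
    (hdeg : ∀ p ∈ P, ((W.filter (G.Adj p)).card : ℝ) ≤ 2 * q * (touch G W v P).card)
    {k : ℕ} (hkq : 2 * k * q ≤ 1) (hk : 0 < k) (a : Fin k → V) (D : Fin k → Finset V)
    (ha : ∀ j, a j ∈ P) (hD : ∀ j, D j ⊆ P)
    (hcross : ∀ j l, j ≠ l → ∀ x ∈ D j, ∀ x' ∈ D l, ¬ G.Adj x x' ∧
      ((G.Adj (a j) x ∧ ¬ G.Adj (a j) x' ∧ G.Adj (a l) x' ∧ ¬ G.Adj (a l) x) ∨
      (G.Adj (a l) x ∧ ¬ G.Adj (a l) x' ∧ G.Adj (a j) x' ∧ ¬ G.Adj (a j) x)))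
    (htouch : ∀ j, (4 / k : ℝ) * (touch G W v P).card ≤ (touch G W v (D j)).card) : False := by
  have ht' : (0 : ℝ) < (touch G W v P).card := by exact_mod_cast ht
  have hk' : (0 : ℝ) < k := by exact_mod_cast hk
  set R : Fin k → Finset V := fun j => touch G W v (D j) \ W.filter (G.Adj (a j)) with hR
  have hdis : ∀ j l, j ≠ l → Disjoint (R j) (R l) := by
    intro j l hjl
    rw [Finset.disjoint_left]
    intro b hb hb'
    simp only [hR, Finset.mem_sdiff, Finset.mem_filter, not_and] at hb hb'
    obtain ⟨hbW, hbv, x, hx, hbx⟩ := mem_touch.1 hb.1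
    obtain ⟨-, -, x', hx', hbx'⟩ := mem_touch.1 hb'.1
    have n1 : ¬ G.Adj b (a j) := fun h => hb.2 hbW h.symm
    have n2 : ¬ G.Adj b (a l) := fun h => hb'.2 hbW h.symm
    obtain ⟨hxx, ⟨h1, h2, -, -⟩ | ⟨h1, h2, -, -⟩⟩ := hcross j l hjl x hx x' hx'
    · exact hG.no_mixed (hP x (hD j hx)) (hP x' (hD l hx')) (hP _ (ha j)) hbv hbx hbx' hxx h1 h2 n1
    · exact hG.no_mixed (hP x (hD j hx)) (hP x' (hD l hx')) (hP _ (ha l)) hbv hbx hbx' hxx h1 h2 n2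
  have hRc : ∀ j, (4 / k - 2 * q : ℝ) * (touch G W v P).card ≤ (R j).card := by
    intro j
    have h1 := Finset.le_card_sdiff (W.filter (G.Adj (a j))) (touch G W v (D j))
    have h2 : ((touch G W v (D j)).card : ℝ) ≤ (R j).card + (W.filter (G.Adj (a j))).card := by
      have : (touch G W v (D j)).card ≤ (R j).card + (W.filter (G.Adj (a j))).card := by
        simp only [hR]
        omega
      exact_mod_cast this
    have h3 := htouch j
    have h4 := hdeg _ (ha j)
    linarith
  have hsum : ∑ j, (R j).card ≤ (touch G W v P).card := by
    rw [← Finset.card_biUnion fun j _ l _ h => hdis j l h]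
    exact Finset.card_le_card (Finset.biUnion_subset.2
      fun j _ => Finset.sdiff_subset.trans (touch_mono (hD j)))
  have hsum' : ∑ j, ((R j).card : ℝ) ≤ (touch G W v P).card := by exact_mod_cast hsum
  have h1 : (k : ℝ) * ((4 / k - 2 * q : ℝ) * (touch G W v P).card) ≤ (touch G W v P).card := by
    refine le_trans ?_ hsum'
    calc _ = ∑ j : Fin k, (4 / k - 2 * q : ℝ) * (touch G W v P).card := by
          rw [Finset.sum_const, Finset.card_univ, Fintype.card_fin, nsmul_eq_mul]
      _ ≤ _ := Finset.sum_le_sum fun j _ => hRc j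
  have h2 : (k : ℝ) * ((4 / k - 2 * q : ℝ) * (touch G W v P).card) =
      (4 - 2 * k * q) * (touch G W v P).card := by
    field_simp
  rw [h2] at h1
  nlinarith

end Core

section Regular
variable {V : Type*} {G : SimpleGraph V}

theorem pow_hundred_le {x u : ℝ} (h : x ^ 2 ≤ u) (hu : u ≤ 1) {n : ℕ}
    (hn : n ≤ 50) : x ^ 100 ≤ u ^ n := by
  have hu0 : 0 ≤ u := (sq_nonneg x).trans h
  calc x ^ 100 = (x ^ 2) ^ 50 := by rw [← pow_mul]
    _ ≤ u ^ 50 := pow_le_pow_left₀ (by positivity) h 50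
    _ ≤ u ^ n := pow_le_pow_of_le_one hu0 hu hn

/-- Minimizing the density of a subset gives one with no much sparser large subset. -/
theorem exists_regular_subset {H : SimpleGraph V} (hH : H = G ∨ H = Gᶜ) {P Q : Finset V} {q : ℝ}
    (hq0 : 0 < q) (hq : q ≤ 1 / 2 ^ 50) (hQP : Q ⊆ P) (hQ0 : Q.Nonempty)
    (hQc : 1 / 2 ^ 20 * (P.card : ℝ) ≤ Q.card)
    (hQd : ∀ w ∈ Q, ((clN H w Q).card : ℝ) ≤ 1 / 2 ^ 16 * Q.card)
    (hdense : ∀ R ⊆ P, (q ^ 2) ^ 2 * (P.card : ℝ) ≤ R.card →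
      ∃ w ∈ R, q * R.card < ((clN Gᶜ w R).card : ℝ))
    (hsparse : ∀ R ⊆ P, (q ^ 2) ^ 2 * (P.card : ℝ) ≤ R.card →
      ∃ w ∈ R, (q ^ 2) ^ 2 * R.card < ((clN G w R).card : ℝ)) :
    ∃ (R : Finset V) (y : ℝ), R ⊆ Q ∧ R.Nonempty ∧ q ^ 2 ≤ y ∧ y ≤ 1 / 2 ^ 16 ∧
      y * Q.card ≤ R.card ∧ (∀ w ∈ R, ((clN H w R).card : ℝ) ≤ y * R.card) ∧
      ∀ T ⊆ R, (R.card : ℝ) ≤ 2 * T.card → ∃ w ∈ T, y ^ 4 * T.card < ((clN H w T).card : ℝ) := by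
  have hq2 : q ^ 2 ≤ 1 / 2 ^ 100 := by
    calc q ^ 2 ≤ (1 / 2 ^ 50) ^ 2 := pow_le_pow_left₀ hq0.le hq 2
      _ = _ := by norm_num
  have hq20 : 0 < q ^ 2 := by positivity
  set f : Finset V → ℝ := fun R => max ((maxClN H R : ℝ) / R.card) (q ^ 2) with hf
  have hQpos : (0 : ℝ) < Q.card := by exact_mod_cast Finset.card_pos.2 hQ0
  have hfQ : f Q ≤ 1 / 2 ^ 16 := by
    refine max_le ?_ (hq2.trans (by norm_num))
    rw [div_le_iff₀ hQpos]
    exact maxClN_le (by positivity) hQd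
  obtain ⟨R, hR, hmin⟩ := Finset.exists_min_image
    (Q.powerset.filter (fun R => R.Nonempty ∧ f R * Q.card ≤ R.card)) f
    ⟨Q, Finset.mem_filter.2 ⟨Finset.mem_powerset_self Q, hQ0, by nlinarith⟩⟩
  have mem : ∀ R, R ∈ Q.powerset.filter (fun R => R.Nonempty ∧ f R * Q.card ≤ R.card) ↔
      R ⊆ Q ∧ R.Nonempty ∧ f R * Q.card ≤ R.card := by
    intro R
    rw [Finset.mem_filter, Finset.mem_powerset]
  obtain ⟨hRQ, hR0, hRc⟩ := (mem R).1 hR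
  have hRpos : (0 : ℝ) < R.card := by exact_mod_cast Finset.card_pos.2 hR0
  set y := f R with hy
  have hqy : q ^ 2 ≤ y := le_max_right _ _
  have hy0 : 0 < y := lt_of_lt_of_le hq20 hqy
  have hy1 : y ≤ 1 / 2 ^ 16 :=
    (hmin Q ((mem Q).2 ⟨subset_rfl, hQ0, by nlinarith⟩)).trans hfQ
  have hRd : ∀ w ∈ R, ((clN H w R).card : ℝ) ≤ y * R.card := by
    intro w hw
    have h1 : ((clN H w R).card : ℝ) ≤ maxClN H R := by exact_mod_cast card_clN_le_maxClN hw
    refine h1.trans ?_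
    rw [← div_le_iff₀ hRpos]
    exact le_max_left _ _
  have large : ∀ T ⊆ R, (R.card : ℝ) ≤ 2 * T.card → (q ^ 2) ^ 2 * (P.card : ℝ) ≤ T.card := by
    intro T hT hTc
    have h1 : q ^ 2 * (1 / 2 ^ 20 * (P.card : ℝ)) ≤ y * Q.card := by gcongr
    have h2 : (q ^ 2) ^ 2 * (P.card : ℝ) ≤ q ^ 2 * (1 / 2 ^ 21 * P.card) := by
      rw [sq (q ^ 2), mul_assoc]
      have : q ^ 2 ≤ 1 / 2 ^ 21 := hq2.trans (by norm_num)
      gcongr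
    linarith
  refine ⟨R, y, hRQ, hR0, hqy, hy1, hRc, hRd, fun T hT hTc => ?_⟩
  by_contra! hcon
  have hTP : T ⊆ P := hT.trans (hRQ.trans hQP)
  have hTpos : (0 : ℝ) < T.card := by linarith
  by_cases hyq : q ^ 2 ≤ y ^ 2
  · have hy2 : y ^ 2 < y / 2 := by nlinarith
    have hfT : f T ≤ y ^ 2 := by
      refine max_le ?_ hyq
      rw [div_le_iff₀ hTpos]
      refine (maxClN_le (by positivity) hcon).trans ?_
      have : y ^ 4 ≤ y ^ 2 := pow_le_pow_of_le_one hy0.le (hy1.trans (by norm_num)) (by norm_num)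
      gcongr
    have h1 := hmin T ((mem T).2 ⟨hT.trans hRQ, Finset.card_pos.1 (by exact_mod_cast hTpos), by
      have : f T * Q.card ≤ y / 2 * Q.card := by
        apply mul_le_mul_of_nonneg_right _ hQpos.le
        linarith
      linarith⟩)
    linarith
  · rw [not_le] at hyq
    have hyq' : y < q := lt_of_pow_lt_pow_left₀ 2 hq0.le hyq
    rcases hH with rfl | rfl
    · obtain ⟨w, hw, hlt⟩ := hsparse T hTP (large T hT hTc)
      have h1 := hcon w hw
      have h2 : y ^ 4 ≤ (q ^ 2) ^ 2 := by
        calc y ^ 4 = (y ^ 2) ^ 2 := by ring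
          _ ≤ (q ^ 2) ^ 2 := by gcongr
      have h3 : y ^ 4 * T.card ≤ (q ^ 2) ^ 2 * T.card := by gcongr
      linarith
    · obtain ⟨w, hw, hlt⟩ := hdense R (hRQ.trans hQP) (large R subset_rfl (by linarith))
      have h1 := hRd w hw
      have h2 : y * R.card ≤ q * R.card := by gcongr
      linarith

/-- In such a subset, the typical closed neighbourhood is large. -/
theorem half_le_card_filter_clN {H : SimpleGraph V} {R : Finset V} {x : ℝ}
    (h : ∀ T ⊆ R, (R.card : ℝ) ≤ 2 * T.card → ∃ w ∈ T, x * T.card < ((clN H w T).card : ℝ))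
    (hx : 0 ≤ x) :
    (R.card : ℝ) / 2 ≤
      (R.filter (fun w => x / 2 * R.card ≤ ((clN H w R).card : ℝ))).card := by
  by_contra! hc
  set T := R.filter (fun w => ¬ x / 2 * R.card ≤ ((clN H w R).card : ℝ)) with hT
  have h1 : ((R.filter (fun w => x / 2 * R.card ≤ ((clN H w R).card : ℝ))).card : ℝ) + T.card =
      R.card := by
    exact_mod_cast Finset.card_filter_add_card_filter_not _
  have h2 : (R.card : ℝ) ≤ 2 * T.card := by linarith
  obtain ⟨w, hw, hlt⟩ := h T (Finset.filter_subset _ _) h2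
  have h3 := not_le.1 (Finset.mem_filter.1 hw).2
  have h4 : ((clN H w T).card : ℝ) ≤ (clN H w R).card :=
    card_filter_clN_le (Finset.filter_subset _ _)
  nlinarith

/-- Some vertex of `touch G W v P` sees many mixed vertices of `R`. -/
theorem exists_mixed_vertex {H : SimpleGraph V} {W P R : Finset V} {v : V} {q z : ℝ}
    (hz0 : 0 < z) (hz : z ≤ 1 / 2 ^ 8) (hqz : q ≤ z) (hqz7 : (q ^ 2) ^ 7 ≤ (z ^ 2) ^ 7)
    (hT : TouchLarge G W v P ((q ^ 2) ^ 7)) (ht : 0 < (touch G W v P).card)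
    (hdeg : ∀ p ∈ P, ((W.filter (G.Adj p)).card : ℝ) ≤ 2 * q * (touch G W v P).card)
    (hRP : R ⊆ P) (hR0 : R.Nonempty) (hRc : z ^ 2 * (1 / 2 ^ 20 * P.card) ≤ (R.card : ℝ))
    (hR : ∀ T ⊆ R, (R.card : ℝ) ≤ 2 * T.card →
      ∃ w ∈ T, (z ^ 2) ^ 4 * T.card < ((clN H w T).card : ℝ)) :
    ∃ b ∈ touch G W v P, 4 * z * R.card ≤
      ((R.filter (fun w => ¬ G.Adj b w ∧ ∃ i ∈ R.filter (G.Adj b), H.Adj i w)).card : ℝ) := by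
  have ht' : (0 : ℝ) < (touch G W v P).card := by exact_mod_cast ht
  have hRpos : (0 : ℝ) < R.card := by exact_mod_cast Finset.card_pos.2 hR0
  have hP0 : P.Nonempty := hR0.mono hRP
  have hz1 : z ≤ 1 := hz.trans (by norm_num)
  have hhalf := half_le_card_filter_clN hR (by positivity)
  set L := R.filter (fun w => (z ^ 2) ^ 4 / 2 * R.card ≤ ((clN H w R).card : ℝ)) with hL
  set S : V → Finset V := fun b =>
    R.filter (fun w => ¬ G.Adj b w ∧ ∃ i ∈ R.filter (G.Adj b), H.Adj i w) with hS
  have hrow : ∀ w ∈ L, 14 * z * (touch G W v P).card ≤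
      (((touch G W v P).filter (fun b => w ∈ S b)).card : ℝ) := by
    intro w hw
    obtain ⟨hwR, hwL⟩ := Finset.mem_filter.1 hw
    have h1 : (z ^ 2) ^ 7 * P.card ≤ ((clN H w R).card : ℝ) := by
      refine le_trans ?_ hwL
      have hz4 : (z ^ 2) ^ 2 ≤ 1 / 2 ^ 21 := by
        calc (z ^ 2) ^ 2 ≤ ((1 / 2 ^ 8) ^ 2) ^ 2 := by gcongr
          _ ≤ 1 / 2 ^ 21 := by norm_num
      calc (z ^ 2) ^ 7 * (P.card : ℝ) = (z ^ 2) ^ 4 * z ^ 2 * ((z ^ 2) ^ 2 * P.card) := by ring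
        _ ≤ (z ^ 2) ^ 4 * z ^ 2 * (1 / 2 ^ 21 * P.card) := by gcongr
        _ = (z ^ 2) ^ 4 / 2 * (z ^ 2 * (1 / 2 ^ 20 * P.card)) := by ring
        _ ≤ _ := by gcongr
    have h2 := hT.le (x := 16 * z) (clN_subset.trans hRP) hP0 hqz7 h1 (by
      rw [← pow_mul]
      exact pow_hundred_le (by nlinarith) hz1 (by norm_num))
    have hsub : touch G W v (clN H w R) ⊆
        (touch G W v P).filter (fun b => w ∈ S b) ∪ W.filter (G.Adj w) := by
      intro b hb
      obtain ⟨hbW, hbv, i, hi, hbi⟩ := mem_touch.1 hb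
      by_cases hbw : G.Adj w b
      · exact Finset.mem_union_right _ (Finset.mem_filter.2 ⟨hbW, hbw⟩)
      · have hbw' : ¬ G.Adj b w := fun h => hbw h.symm
        refine Finset.mem_union_left _ (Finset.mem_filter.2
          ⟨touch_mono (clN_subset.trans hRP) hb, Finset.mem_filter.2 ⟨hwR, hbw', i, ?_, ?_⟩⟩)
        · exact Finset.mem_filter.2 ⟨(mem_clN.1 hi).1, hbi⟩
        · rcases (mem_clN.1 hi).2 with rfl | h
          · exact absurd hbi hbw'
          · exact h.symm
    have h3 := (Finset.card_le_card hsub).trans (Finset.card_union_le _ _)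
    have h4 : ((touch G W v (clN H w R)).card : ℝ) ≤
        ((touch G W v P).filter (fun b => w ∈ S b)).card + (W.filter (G.Adj w)).card := by
      exact_mod_cast h3
    have h5 := hdeg w (hRP hwR)
    have h6 : q * (touch G W v P).card ≤ z * (touch G W v P).card := by gcongr
    linarith
  by_contra! hcon
  have e1 := Finset.sum_card_bipartiteAbove_eq_sum_card_bipartiteBelow
    (s := L) (t := touch G W v P) (fun w b => w ∈ S b)
  simp only [Finset.bipartiteAbove, Finset.bipartiteBelow] at e1
  have e2 : ∑ w ∈ L, (((touch G W v P).filter (fun b => w ∈ S b)).card : ℝ) =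
      ∑ b ∈ touch G W v P, ((L.filter (fun w => w ∈ S b)).card : ℝ) := by exact_mod_cast e1
  have e3 : (L.card : ℝ) * (14 * z * (touch G W v P).card) ≤
      ∑ w ∈ L, (((touch G W v P).filter (fun b => w ∈ S b)).card : ℝ) := by
    rw [← nsmul_eq_mul, ← Finset.sum_const]
    exact Finset.sum_le_sum hrow
  have e4 : ∑ b ∈ touch G W v P, ((L.filter (fun w => w ∈ S b)).card : ℝ) ≤
      (touch G W v P).card * (4 * z * R.card) := by
    rw [← nsmul_eq_mul, ← Finset.sum_const]
    refine Finset.sum_le_sum fun b hb => le_trans ?_ (hcon b hb).le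
    have : L.filter (fun w => w ∈ S b) ⊆ S b := fun w hw => (Finset.mem_filter.1 hw).2
    exact_mod_cast Finset.card_le_card this
  have e5 : (R.card : ℝ) / 2 * (14 * z * (touch G W v P).card) ≤
      L.card * (14 * z * (touch G W v P).card) := by gcongr
  have e6 : 0 < z * (touch G W v P).card * R.card := by positivity
  nlinarith

end Regular

section CoreContradiction
variable {V : Type*} {G : SimpleGraph V}

/-- A neighbourhood in which touching sets grow quickly contains a wide anticomplete blockade, or
a large subset that is too dense or too sparse. -/
theorem HouseFree.touch_contradiction (hG : HouseFree G) {W P : Finset V} {v : V} {q : ℝ}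
    (hq0 : 0 < q) (hq : q ≤ 1 / 2 ^ 50) (hP : ∀ p ∈ P, G.Adj v p)
    (hT : TouchLarge G W v P ((q ^ 2) ^ 7)) (ht : 0 < (touch G W v P).card)
    (hPc : 2 ^ 37 ≤ (P.card : ℝ))
    (hdeg : ∀ p ∈ P, ((W.filter (G.Adj p)).card : ℝ) ≤ 2 * q * (touch G W v P).card)
    (hdense : ∀ R ⊆ P, (q ^ 2) ^ 2 * (P.card : ℝ) ≤ R.card →
      ∃ w ∈ R, q * R.card < ((clN Gᶜ w R).card : ℝ))
    (hsparse : ∀ R ⊆ P, (q ^ 2) ^ 2 * (P.card : ℝ) ≤ R.card →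
      ∃ w ∈ R, (q ^ 2) ^ 2 * R.card < ((clN G w R).card : ℝ))
    (hblock : ∀ (k : ℕ) (D : Fin k → Finset V), 32 ≤ k → 1 < q ^ 2 * (k : ℝ) ^ 8 →
      (∀ j, D j ⊆ P ∧ (P.card : ℝ) ≤ (k : ℝ) ^ 12 * (D j).card) →
      (∀ j l, j ≠ l → Disjoint (D j) (D l) ∧ AnticompletePair G (D j) (D l)) → False) :
    False := by
  have hq1 : q ^ 2 ≤ 1 / 2 ^ 100 := by
    calc q ^ 2 ≤ (1 / 2 ^ 50) ^ 2 := pow_le_pow_left₀ hq0.le hq 2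
      _ = _ := by norm_num
  have hc7 : (q ^ 2) ^ 7 ≤ 1 / 2 ^ 37 := by
    calc (q ^ 2) ^ 7 ≤ (1 / 2 ^ 100) ^ 7 := pow_le_pow_left₀ (by positivity) hq1 7
      _ ≤ _ := by norm_num
  obtain ⟨H, hH, Q, hQP, hQc, hQd⟩ := hG.exists_restricted hP hT hc7 ht
    (hq.trans (by norm_num)) hPc hdeg
  have hPpos : (0 : ℝ) < P.card := by linarith
  have hP0 : P.Nonempty := Finset.card_pos.1 (by exact_mod_cast hPpos)
  have hQpos : (0 : ℝ) < Q.card := by linarith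
  obtain ⟨R, y, hRQ, hR0, hqy, hy1, hRc, hRd, hR⟩ := exists_regular_subset hH hq0 hq hQP
    (Finset.card_pos.1 (by exact_mod_cast hQpos)) hQc hQd hdense hsparse
  have hy0 : 0 < y := lt_of_lt_of_le (by positivity) hqy
  obtain ⟨z, hz0, rfl⟩ : ∃ z : ℝ, 0 < z ∧ y = z ^ 2 :=
    ⟨√y, Real.sqrt_pos.2 hy0, (Real.sq_sqrt hy0.le).symm⟩
  have hqz : q ≤ z := le_of_pow_le_pow_left₀ two_ne_zero hz0.le hqy
  have hz1 : z ≤ 1 / 2 ^ 8 :=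
    le_of_pow_le_pow_left₀ two_ne_zero (by norm_num) (hy1.trans (by norm_num))
  have hRP : R ⊆ P := hRQ.trans hQP
  have hRpos : (0 : ℝ) < R.card := by exact_mod_cast Finset.card_pos.2 hR0
  have hRc' : z ^ 2 * (1 / 2 ^ 20 * P.card) ≤ (R.card : ℝ) := by
    refine le_trans ?_ hRc
    gcongr
  obtain ⟨b, hb, hbM⟩ := exists_mixed_vertex hz0 hz1 hqz
    (pow_le_pow_left₀ (by positivity) hqy 7) hT ht hdeg hRP hR0 hRc' hR
  set M := R.filter (fun w => ¬ G.Adj b w ∧ ∃ i ∈ R.filter (G.Adj b), H.Adj i w) with hM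
  obtain ⟨-, hbv, -⟩ := mem_touch.1 hb
  have hs : (maxClN H R : ℝ) ≤ z ^ 2 * R.card := maxClN_le (by positivity) hRd
  have hMpos : (0 : ℝ) < M.card := lt_of_lt_of_le (by positivity) hbM
  obtain ⟨k, a, D, h1, h2, h3, h4⟩ := exists_comb H.Adj (R.filter (G.Adj b)) R.card (maxClN H R) M
    (fun w hw => (Finset.mem_filter.1 hw).2.2)
    (fun i hi => (Finset.card_le_card (fun w hw => mem_clN.2
      ⟨(Finset.mem_filter.1 (Finset.mem_filter.1 hw).1).1, Or.inr (Finset.mem_filter.1 hw).2⟩)).trans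
      (card_clN_le_maxClN (Finset.mem_filter.1 hi).1))
    (Finset.card_pos.1 (by exact_mod_cast hMpos))
    (by
      have : 16 * (R.card : ℝ) * maxClN H R ≤ (M.card : ℝ) ^ 2 := by
        calc 16 * (R.card : ℝ) * maxClN H R ≤ 16 * R.card * (z ^ 2 * R.card) := by gcongr
          _ = (4 * z * R.card) ^ 2 := by ring
          _ ≤ _ := by gcongr
      exact_mod_cast this)
  have h3' : ∀ j, (R.card : ℝ) ≤ 256 * (k : ℝ) ^ 2 * (D j).card := fun j => by
    exact_mod_cast h3 j
  have h4' : (R.card : ℝ) ≤ 64 * (k : ℝ) ^ 2 * maxClN H R := by exact_mod_cast h4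
  have hkz : 1 ≤ 64 * (k : ℝ) ^ 2 * z ^ 2 := by
    have : (R.card : ℝ) * 1 ≤ R.card * (64 * (k : ℝ) ^ 2 * z ^ 2) := by
      calc (R.card : ℝ) * 1 ≤ 64 * (k : ℝ) ^ 2 * maxClN H R := by linarith
        _ ≤ 64 * (k : ℝ) ^ 2 * (z ^ 2 * R.card) := by gcongr
        _ = _ := by ring
    exact le_of_mul_le_mul_left this hRpos
  have hk32' : (32 : ℝ) ≤ k := by
    apply le_of_pow_le_pow_left₀ two_ne_zero (by positivity)
    have : 64 * (k : ℝ) ^ 2 * z ^ 2 ≤ 64 * (k : ℝ) ^ 2 * (1 / 2 ^ 16) := by gcongr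
    linarith
  have hk32 : 32 ≤ k := by exact_mod_cast hk32'
  have hk0 : (0 : ℝ) < k := by linarith
  have hDc : ∀ j, (P.card : ℝ) ≤ (k : ℝ) ^ 12 * (D j).card := by
    intro j
    have hk8 : (2 : ℝ) ^ 40 ≤ (k : ℝ) ^ 8 := by
      calc (2 : ℝ) ^ 40 = 32 ^ 8 := by norm_num
        _ ≤ (k : ℝ) ^ 8 := by gcongr
    calc (P.card : ℝ) = 1 * P.card := by ring
      _ ≤ 64 * (k : ℝ) ^ 2 * z ^ 2 * P.card := by gcongr
      _ = 2 ^ 26 * (k : ℝ) ^ 2 * (z ^ 2 * (1 / 2 ^ 20 * P.card)) := by ring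
      _ ≤ 2 ^ 26 * (k : ℝ) ^ 2 * (256 * (k : ℝ) ^ 2 * (D j).card) := by
        exact mul_le_mul_of_nonneg_left (hRc'.trans (h3' j)) (by positivity)
      _ = 2 ^ 34 * ((k : ℝ) ^ 4 * (D j).card) := by ring
      _ ≤ (k : ℝ) ^ 8 * ((k : ℝ) ^ 4 * (D j).card) := by
        gcongr
        exact le_trans (by norm_num) hk8
      _ = _ := by ring
  have hDP : ∀ j, D j ⊆ P := fun j =>
    (h1 j).2.1.trans ((Finset.filter_subset _ _).trans hRP)
  have haR : ∀ j, a j ∈ P ∧ G.Adj b (a j) := fun j => by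
    have := Finset.mem_filter.1 (h1 j).1
    exact ⟨hRP this.1, this.2⟩
  have hdisj : ∀ j l, j ≠ l → Disjoint (D j) (D l) := by
    intro j l hjl
    rw [Finset.disjoint_left]
    exact fun w hw hw' => h2 l j hjl.symm w hw' ((h1 j).2.2 w hw)
  have hcross : ∀ j l, j ≠ l → ∀ x ∈ D j, ∀ x' ∈ D l, ¬ G.Adj x x' ∧
      ((G.Adj (a j) x ∧ ¬ G.Adj (a j) x' ∧ G.Adj (a l) x' ∧ ¬ G.Adj (a l) x) ∨
      (G.Adj (a l) x ∧ ¬ G.Adj (a l) x' ∧ G.Adj (a j) x' ∧ ¬ G.Adj (a j) x)) := by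
    intro j l hjl x hx x' hx'
    exact hG.comb_anticomplete hH hbv (hP _ (haR j).1) (hP _ (haR l).1) (hP x (hDP j hx))
      (haR j).2 (haR l).2 (Finset.mem_filter.1 ((h1 j).2.1 hx)).2.1
      (Finset.mem_filter.1 ((h1 l).2.1 hx')).2.1 ((h1 j).2.2 x hx) ((h1 l).2.2 x' hx')
      (h2 l j hjl.symm x' hx') (h2 j l hjl x hx)
  by_cases hbig : 1 < q ^ 2 * (k : ℝ) ^ 8
  · exact hblock k D hk32 hbig (fun j => ⟨hDP j, hDc j⟩) fun j l hjl =>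
      ⟨hdisj j l hjl, fun x hx x' hx' => (hcross j l hjl x hx x' hx').1⟩
  · rw [not_lt] at hbig
    have hqk : q * (k : ℝ) ^ 4 ≤ 1 := by
      apply le_of_pow_le_pow_left₀ two_ne_zero (by norm_num)
      calc (q * (k : ℝ) ^ 4) ^ 2 = q ^ 2 * (k : ℝ) ^ 8 := by ring
        _ ≤ 1 ^ 2 := by linarith
    have hk1 : (1 : ℝ) ≤ k := by linarith
    have hk3 : (2 : ℝ) ≤ (k : ℝ) ^ 3 := by
      calc (2 : ℝ) ≤ 32 ^ 3 := by norm_num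
        _ ≤ (k : ℝ) ^ 3 := by gcongr
    refine hG.no_touching_comb hP ht hdeg (k := k) ?_ (by omega) a D (fun j => (haR j).1) hDP
      hcross fun j => ?_
    · calc 2 * (k : ℝ) * q ≤ (k : ℝ) ^ 3 * k * q := by gcongr
        _ = q * (k : ℝ) ^ 4 := by ring
        _ ≤ 1 := hqk
    · refine hT.le (d := (1 / k) ^ 12) (hDP j) hP0 ?_ ?_ ?_
      · have h5 : q ^ 2 ≤ (1 / k) ^ 8 := by
          rw [div_pow, one_pow, le_div_iff₀ (by positivity)]
          exact hbig
        calc (q ^ 2) ^ 7 ≤ ((1 / k : ℝ) ^ 8) ^ 7 := by gcongr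
          _ = (1 / k : ℝ) ^ 56 := by rw [← pow_mul]
          _ ≤ (1 / k : ℝ) ^ 12 := pow_le_pow_of_le_one (by positivity)
            (by rw [div_le_one hk0]; exact hk1) (by norm_num)
      · rw [div_pow, one_pow, div_mul_eq_mul_div, div_le_iff₀ (by positivity), one_mul, mul_comm]
        exact hDc j
      · apply pow_hundred_le _ _ (by norm_num)
        · rw [div_pow, div_le_div_iff₀ (by positivity) hk0]
          nlinarith
        · rw [div_le_one hk0]; exact hk1

end CoreContradiction

section Extract
variable {V : Type*} {G : SimpleGraph V}

/-- `U` contains no blockade with `k ≥ 2` pieces of size at least `|U| / k ^ d`,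
anticomplete in `G` or in its complement. -/
def NoBlockade (G : SimpleGraph V) (U : Finset V) (d : ℕ) : Prop :=
  ∀ k : ℕ, 2 ≤ k → ∀ H, (H = G ∨ H = Gᶜ) → ∀ w : ℝ, Blockade H U k w → w * k ^ d < U.card

theorem NoBlockade.false {U : Finset V} {d k l m n : ℕ} {H : SimpleGraph V} {w x : ℝ}
    (h : NoBlockade G U d) (hk : 2 ≤ k) (hH : H = G ∨ H = Gᶜ) (hB : Blockade H U k w)
    (hw0 : 0 ≤ w) (hw : x ^ n * U.card ≤ (k : ℝ) ^ m * w) (hx : 1 ≤ x * (k : ℝ) ^ l)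
    (hd : l * n + m ≤ d) : False := by
  have hk1 : (1 : ℝ) ≤ k := by exact_mod_cast (by omega : 1 ≤ k)
  refine absurd (h k hk H hH w hB) (not_lt.2 ?_)
  calc (U.card : ℝ) = 1 * U.card := by ring
    _ ≤ (x * (k : ℝ) ^ l) ^ n * U.card :=
        mul_le_mul_of_nonneg_right (one_le_pow₀ hx) (Nat.cast_nonneg _)
    _ = (k : ℝ) ^ (l * n) * (x ^ n * U.card) := by rw [mul_pow, ← pow_mul]; ring
    _ ≤ (k : ℝ) ^ (l * n) * ((k : ℝ) ^ m * w) := mul_le_mul_of_nonneg_left hw (by positivity)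
    _ = w * (k : ℝ) ^ (l * n + m) := by rw [pow_add]; ring
    _ ≤ w * (k : ℝ) ^ d := mul_le_mul_of_nonneg_left (pow_le_pow_right₀ hk1 hd) hw0

/-- The vertices of `W` in the closed neighbourhood of the set `P`. -/
noncomputable def clNSet (G : SimpleGraph V) (P W : Finset V) : Finset V :=
  W.filter (fun b => ∃ p ∈ P, b = p ∨ G.Adj p b)

theorem blockade_of_extract {S : Finset V} {m x c : ℝ}
    (h : ∀ W ⊆ S, c ≤ W.card → ∃ P ⊆ W, m ≤ P.card ∧ ((clNSet G P W).card : ℝ) ≤ x) (hx : 0 ≤ x)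
    (k : ℕ) : ∀ W ⊆ S, c + k * x ≤ W.card → Blockade G W k m := by
  induction k with
  | zero =>
    intro W _ _
    exact ⟨Fin 0, inferInstance, fun _ => ∅, by simp, fun i => i.elim0, fun i => i.elim0⟩
  | succ k ih =>
    intro W hW hc
    push_cast at hc
    have hkx : 0 ≤ (k : ℝ) * x := by positivity
    obtain ⟨P, hP, hm, hPx⟩ := h W hW (by linarith)
    set N := clNSet G P W with hN
    have hNW : N ⊆ W := Finset.filter_subset _ _
    have hcard : ((W \ N).card : ℝ) + N.card = W.card := by
      exact_mod_cast Finset.card_sdiff_add_card_eq_card hNW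
    have h1 := ih (W \ N) (Finset.sdiff_subset.trans hW) (by linarith)
    have h2 : Blockade G P 1 m := ⟨Fin 1, inferInstance, fun _ => P, by simp,
      fun _ => ⟨subset_rfl, hm⟩, fun i j hij => absurd (Subsingleton.elim i j) hij⟩
    have key : ∀ a ∈ W \ N, ∀ p ∈ P, ¬ (a = p ∨ G.Adj p a) := by
      intro a ha p hp hap
      obtain ⟨haW, haN⟩ := Finset.mem_sdiff.1 ha
      exact haN (Finset.mem_filter.2 ⟨haW, p, hp, hap⟩)
    exact Blockade.sum Finset.sdiff_subset hP
      (Finset.disjoint_left.2 fun a ha hp => key a ha a hp (Or.inl rfl))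
      (fun a ha p hp hap => key a ha p hp (Or.inr hap.symm)) h1 h2

theorem NoBlockade.not_dense (hG : HouseFree G) {U R : Finset V} {d : ℕ} {q : ℝ} (hd : 2400 ≤ d)
    (hU : NoBlockade G U d) (hq0 : 0 < q) (hq : q ≤ 1 / 2 ^ 50) (hR : R ⊆ U) (hR0 : 0 < R.card)
    (hRc : q ^ 232 * U.card ≤ R.card) : ∃ w ∈ R, q * R.card < (clN Gᶜ w R).card := by
  by_contra hcon
  simp only [not_exists, not_and, not_lt] at hcon
  have hR0' : (0 : ℝ) < R.card := by exact_mod_cast hR0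
  obtain ⟨j, hj1, hj2⟩ := exists_nat_pow_near (x := 1 / (100 * q)) (y := 20)
    (by rw [le_div_iff₀ (by positivity)]; linarith) (by norm_num)
  rw [le_div_iff₀ (by positivity)] at hj1
  rw [div_lt_iff₀ (by positivity), pow_succ] at hj2
  have hB := hG.blockade_of_dense (mul_pos hq0 hR0') j R hcon (by nlinarith)
  have hbig : (2000 : ℝ) ≤ 20 ^ j := by
    by_contra! hc
    have : (20 : ℝ) ^ j * q ≤ 2000 * (1 / 2 ^ 50) := by gcongr
    nlinarith
  have hj : 1 ≤ j := by
    rcases Nat.eq_zero_or_pos j with rfl | h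
    · norm_num at hbig
    · exact h
  have hk2 : 2 ≤ 2 ^ j := by
    calc 2 = 2 ^ 1 := by norm_num
      _ ≤ 2 ^ j := Nat.pow_le_pow_right (by norm_num) hj
  have h20 : (20 : ℝ) ^ j ≤ ((2 ^ j : ℕ) : ℝ) ^ 5 := by
    push_cast
    rw [← pow_mul, mul_comm, pow_mul]
    gcongr
    norm_num
  refine hU.false (l := 10) (m := 5) (n := 232) (x := q) hk2 (Or.inr rfl)
    (hB.mono hR le_rfl) (by positivity) ?_ ?_ (by omega)
  · refine hRc.trans ?_
    calc (R.card : ℝ) = 20 ^ j * (R.card / 20 ^ j) := by field_simp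
      _ ≤ _ := mul_le_mul_of_nonneg_right h20 (by positivity)
  · have h1 : (20 : ℝ) ^ j * 20 ^ j ≤ ((2 ^ j : ℕ) : ℝ) ^ 10 := by
      calc (20 : ℝ) ^ j * 20 ^ j ≤ ((2 ^ j : ℕ) : ℝ) ^ 5 * ((2 ^ j : ℕ) : ℝ) ^ 5 := by gcongr
        _ = _ := by ring
    have h2 : 2000 * ((20 : ℝ) ^ j * q) ≤ 20 ^ j * (20 ^ j * q) := by gcongr
    have h3 := mul_le_mul_of_nonneg_left h1 hq0.le
    nlinarith

end Extract

section Claim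
variable {V : Type*} {G : SimpleGraph V}

/-- Among the subsets of `P₀` of size at least `m`, the one minimising `|touch P| ^ 100 / |P|`. -/
theorem exists_touchLarge {W P₀ : Finset V} {v : V} {m c : ℝ} (hm : 0 < m)
    (hP₀ : m ≤ P₀.card) :
    ∃ P ⊆ P₀, m ≤ P.card ∧
      (P₀.card : ℝ) * ((touch G W v P).card : ℝ) ^ 100 ≤
        ((touch G W v P₀).card : ℝ) ^ 100 * P.card ∧
      (m ≤ c * P.card → TouchLarge G W v P c) := by
  obtain ⟨P, hP, hmin⟩ := Finset.exists_min_image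
    (P₀.powerset.filter (fun P => m ≤ (P.card : ℝ)))
    (fun P => ((touch G W v P).card : ℝ) ^ 100 / P.card)
    ⟨P₀, Finset.mem_filter.2 ⟨Finset.mem_powerset_self _, hP₀⟩⟩
  obtain ⟨hPP, hPm⟩ := Finset.mem_filter.1 hP
  have hPP := Finset.mem_powerset.1 hPP
  have key : ∀ X ⊆ P₀, m ≤ X.card → (X.card : ℝ) * ((touch G W v P).card : ℝ) ^ 100 ≤
        ((touch G W v X).card : ℝ) ^ 100 * P.card := by
    intro X hX hXm
    have h := hmin X (Finset.mem_filter.2 ⟨Finset.mem_powerset.2 hX, hXm⟩)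
    rw [div_le_div_iff₀ (hm.trans_le hPm) (hm.trans_le hXm)] at h
    linarith
  exact ⟨P, hPP, hPm, key P₀ subset_rfl hP₀,
    fun hc X hX hXc => key X (hX.trans hPP) (hc.trans hXc)⟩

theorem HouseFree.exists_small_clNSet (hG : HouseFree G) {U S W : Finset V} {q : ℝ} {d : ℕ}
    (hd : 2400 ≤ d) (hU : NoBlockade G U d) (hq0 : 0 < q) (hq : q ≤ 1 / 2 ^ 50)
    (hSU : S ⊆ U) (hSc : q ^ 120 * U.card ≤ S.card) (hbig : 1 < q ^ 240 * U.card)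
    (hdeg : ∀ w ∈ S, ((clN G w S).card : ℝ) ≤ q ^ 2 * S.card)
    (hstuck : ∀ T ⊆ S, q ^ 120 * S.card ≤ T.card → ∃ w ∈ T, q ^ 4 * T.card < (clN G w T).card)
    (hW : W ⊆ S) (hWc : (S.card : ℝ) / 2 ≤ W.card) :
    ∃ P ⊆ W, q ^ 124 * S.card ≤ P.card ∧ ((clNSet G P W).card : ℝ) ≤ q * S.card := by
  by_contra hcon
  have hcon' : ∀ P ⊆ W, q ^ 124 * S.card ≤ P.card → q * S.card < (clNSet G P W).card := by
    intro P hP hPc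
    by_contra hc
    exact hcon ⟨P, hP, hPc, not_lt.1 hc⟩
  clear hcon
  have hq1 : q ≤ 1 := hq.trans (by norm_num)
  have hqp : ∀ a b : ℕ, a ≤ b → q ^ b ≤ q ^ a := fun a b h => pow_le_pow_of_le_one hq0.le hq1 h
  set N := (U.card : ℝ) with hN
  set s := (S.card : ℝ) with hs
  have hs1 : 1 < q ^ 120 * s := by
    calc 1 < q ^ 240 * N := hbig
      _ = q ^ 120 * (q ^ 120 * N) := by ring
      _ ≤ q ^ 120 * s := mul_le_mul_of_nonneg_left hSc (by positivity)
  have hs0 : 0 < s := by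
    by_contra hc
    nlinarith [pow_pos hq0 120]
  have hmul : ∀ a b : ℕ, a ≤ b → q ^ b * s ≤ q ^ a * s :=
    fun a b h => mul_le_mul_of_nonneg_right (hqp a b h) hs0.le
  have hq2 : q ^ 2 ≤ 1 / 2 ^ 100 := by
    calc q ^ 2 ≤ (1 / 2 ^ 50) ^ 2 := by gcongr
      _ = _ := by norm_num
  obtain ⟨v, hv, hvd⟩ := hstuck W hW (by
    have : q ^ 120 * s ≤ q ^ 2 * s := hmul 2 120 (by norm_num)
    have : q ^ 2 * s ≤ 1 / 2 ^ 100 * s := mul_le_mul_of_nonneg_right hq2 hs0.le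
    linarith)
  set P₀ := W.filter (G.Adj v) with hP₀
  have hP₀c : q ^ 6 * s ≤ P₀.card := by
    have h1 : (clN G v W).card ≤ P₀.card + 1 := by
      have : clN G v W ⊆ insert v P₀ := by
        intro u hu
        obtain ⟨hu, rfl | h⟩ := mem_clN.1 hu
        · exact Finset.mem_insert_self _ _
        · exact Finset.mem_insert_of_mem (Finset.mem_filter.2 ⟨hu, h⟩)
      exact (Finset.card_le_card this).trans (Finset.card_insert_le _ _)
    have h1' : ((clN G v W).card : ℝ) ≤ P₀.card + 1 := by exact_mod_cast h1
    have h2 : q ^ 4 * (s / 2) ≤ q ^ 4 * W.card := mul_le_mul_of_nonneg_left hWc (by positivity)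
    have h3 : q ^ 120 * s ≤ q ^ 6 * s := hmul 6 120 (by norm_num)
    have h4 : q ^ 6 * s ≤ 1 / 2 ^ 100 * (q ^ 4 * s) := by
      calc q ^ 6 * s = q ^ 2 * (q ^ 4 * s) := by ring
        _ ≤ _ := mul_le_mul_of_nonneg_right hq2 (by positivity)
    have h5 : 0 < q ^ 4 * s := by positivity
    linarith
  have hP₀W : P₀ ⊆ W := Finset.filter_subset _ _
  have htouch : ∀ X ⊆ P₀, q ^ 124 * s ≤ X.card → q / 2 * s ≤ (touch G W v X).card := by
    intro X hX hXc
    have h1 := hcon' X (hX.trans hP₀W) hXc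
    have h2 : clNSet G X W ⊆ touch G W v X ∪ clN G v S := by
      intro b hb
      obtain ⟨hbW, p, hp, hbp⟩ := Finset.mem_filter.1 hb
      by_cases hvb : G.Adj v b
      · exact Finset.mem_union_right _ (mem_clN.2 ⟨hW hbW, Or.inr hvb⟩)
      · refine Finset.mem_union_left _ (mem_touch.2 ⟨hbW, fun h => hvb h.symm, p, hp, ?_⟩)
        rcases hbp with rfl | h
        · exact absurd (Finset.mem_filter.1 (hX hp)).2 hvb
        · exact h.symm
    have h3 : ((clNSet G X W).card : ℝ) ≤ (touch G W v X).card + (clN G v S).card := by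
      exact_mod_cast (Finset.card_le_card h2).trans (Finset.card_union_le _ _)
    have h4 := hdeg v (hW hv)
    have h5 : q ^ 2 * s ≤ q * s * (1 / 2 ^ 50) := by
      calc q ^ 2 * s = q * s * q := by ring
        _ ≤ _ := mul_le_mul_of_nonneg_left hq (by positivity)
    have h6 : 0 < q * s := by positivity
    linarith
  obtain ⟨P, hP, hPm, hPmin, hPT⟩ := exists_touchLarge (G := G) (W := W) (v := v) (P₀ := P₀)
    (m := q ^ 124 * s) (c := (q ^ 2) ^ 7) (by positivity) ((hmul 6 124 (by norm_num)).trans hP₀c)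
  have ht := htouch P hP hPm
  have hPc : q ^ 108 * s ≤ P.card := by
    have h1 : (touch G W v P₀).card ≤ S.card :=
      Finset.card_le_card ((Finset.filter_subset _ _).trans hW)
    have h1' : ((touch G W v P₀).card : ℝ) ≤ s := Nat.cast_le.2 h1
    have h2 : (P₀.card : ℝ) * (q / 2 * s) ^ 100 ≤ s ^ 100 * P.card := by
      calc (P₀.card : ℝ) * (q / 2 * s) ^ 100 ≤ P₀.card * ((touch G W v P).card : ℝ) ^ 100 := by
            gcongr
        _ ≤ _ := hPmin
        _ ≤ _ := by gcongr
    have h3 : s ^ 100 * ((q / 2) ^ 100 * P₀.card) ≤ s ^ 100 * P.card := by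
      calc _ = (P₀.card : ℝ) * (q / 2 * s) ^ 100 := by rw [mul_pow]; ring
        _ ≤ _ := h2
    have h4 := le_of_mul_le_mul_left h3 (by positivity)
    have h5 : q ^ 102 ≤ (q / 2) ^ 100 := by
      calc q ^ 102 = q ^ 100 * q ^ 2 := by ring
        _ ≤ q ^ 100 * (1 / 2 ^ 100) := mul_le_mul_of_nonneg_left hq2 (by positivity)
        _ = (q / 2) ^ 100 := by rw [div_pow]; ring
    calc q ^ 108 * s = q ^ 102 * (q ^ 6 * s) := by ring
      _ ≤ (q / 2) ^ 100 * P₀.card := by gcongr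
      _ ≤ P.card := h4
  have hPU : q ^ 228 * N ≤ P.card := by
    calc q ^ 228 * N = q ^ 108 * (q ^ 120 * N) := by ring
      _ ≤ q ^ 108 * s := mul_le_mul_of_nonneg_left hSc (by positivity)
      _ ≤ _ := hPc
  have hPS : P ⊆ S := (hP.trans hP₀W).trans hW
  have hR : ∀ R ⊆ P, (q ^ 2) ^ 2 * (P.card : ℝ) ≤ R.card → q ^ 112 * s ≤ R.card := by
    intro R _ hRc
    calc q ^ 112 * s = (q ^ 2) ^ 2 * (q ^ 108 * s) := by ring
      _ ≤ (q ^ 2) ^ 2 * P.card := by gcongr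
      _ ≤ _ := hRc
  refine hG.touch_contradiction (W := W) (P := P) (v := v) hq0 hq
    (fun p hp => (Finset.mem_filter.1 (hP hp)).2) (hPT ?_) ?_ ?_ ?_ ?_ ?_ ?_
  · calc q ^ 124 * s ≤ q ^ 122 * s := hmul 122 124 (by norm_num)
      _ = (q ^ 2) ^ 7 * (q ^ 108 * s) := by ring
      _ ≤ _ := by gcongr
  · have : (0 : ℝ) < (touch G W v P).card := lt_of_lt_of_le (by positivity) ht
    exact_mod_cast this
  · have h1 : 1 ≤ q ^ 12 * P.card := by
      calc 1 ≤ q ^ 240 * N := hbig.le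
        _ = q ^ 12 * (q ^ 228 * N) := by ring
        _ ≤ _ := by gcongr
    have h2 : q ^ 12 ≤ 1 / 2 ^ 37 := by
      calc q ^ 12 ≤ q ^ 2 := hqp 2 12 (by norm_num)
        _ ≤ _ := hq2
        _ ≤ _ := by norm_num
    have h3 : q ^ 12 * (P.card : ℝ) ≤ 1 / 2 ^ 37 * P.card := by gcongr
    linarith
  · intro p hp
    have h1 : W.filter (G.Adj p) ⊆ clN G p S := by
      intro u hu
      obtain ⟨h1, h2⟩ := Finset.mem_filter.1 hu
      exact mem_clN.2 ⟨hW h1, Or.inr h2⟩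
    calc ((W.filter (G.Adj p)).card : ℝ) ≤ (clN G p S).card := by
          exact_mod_cast Finset.card_le_card h1
      _ ≤ q ^ 2 * s := hdeg p (hPS hp)
      _ = 2 * q * (q / 2 * s) := by ring
      _ ≤ _ := by gcongr
  · intro R hRP hRc
    have h1 := hR R hRP hRc
    have h2 : (0 : ℝ) < R.card := lt_of_lt_of_le (by positivity) h1
    refine hU.not_dense hG hd hq0 hq ((hRP.trans hPS).trans hSU) (by exact_mod_cast h2) ?_
    calc q ^ 232 * N = q ^ 112 * (q ^ 120 * N) := by ring
      _ ≤ q ^ 112 * s := mul_le_mul_of_nonneg_left hSc (by positivity)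
      _ ≤ _ := h1
  · intro R hRP hRc
    rw [← pow_mul]
    exact hstuck R (hRP.trans hPS) ((hmul 112 120 (by norm_num)).trans (hR R hRP hRc))
  · intro k D hk hqk hD hDD
    have hk0 : (0 : ℝ) < k := by exact_mod_cast (by omega : 0 < k)
    have hB : Blockade G U k (P.card / (k : ℝ) ^ 12) := by
      refine ⟨Fin k, inferInstance, D, Fintype.card_fin k, fun i => ⟨?_, ?_⟩, hDD⟩
      · exact (hD i).1.trans (hPS.trans hSU)
      · rw [div_le_iff₀ (by positivity), mul_comm]
        exact (hD i).2
    refine hU.false (l := 8) (m := 12) (n := 114) (x := q ^ 2) (by omega) (Or.inl rfl) hB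
      (by positivity) ?_ hqk.le (by omega)
    rw [← pow_mul, mul_div_cancel₀ _ (by positivity)]
    exact hPU

end Claim

section Main
variable {V : Type*} {G : SimpleGraph V}

theorem exists_stable_of_card_clN_le {S : Finset V} {D : ℕ}
    (h : ∀ w ∈ S, (clN G w S).card ≤ D) :
    ∃ T ⊆ S, Gᶜ.IsClique (T : Set V) ∧ S.card ≤ T.card * D := by
  obtain ⟨T, hT, hmax⟩ := Finset.exists_max_image
    (S.powerset.filter (fun T : Finset V => Gᶜ.IsClique (T : Set V))) Finset.card
    ⟨∅, Finset.mem_filter.2 ⟨Finset.empty_mem_powerset _, by simp⟩⟩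
  obtain ⟨hTS, hTc⟩ := Finset.mem_filter.1 hT
  have hTS := Finset.mem_powerset.1 hTS
  refine ⟨T, hTS, hTc, ?_⟩
  have hcov : S ⊆ T.biUnion (fun t => clN G t S) := by
    intro u hu
    by_contra hcon
    have hn : ∀ t ∈ T, ¬ (u = t ∨ G.Adj t u) := fun t ht h =>
      hcon (Finset.mem_biUnion.2 ⟨t, ht, mem_clN.2 ⟨hu, h⟩⟩)
    have huT : u ∉ T := fun h => hn u h (Or.inl rfl)
    have := hmax (insert u T) (Finset.mem_filter.2
      ⟨Finset.mem_powerset.2 (Finset.insert_subset hu hTS), by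
        rw [Finset.coe_insert]
        refine hTc.insert fun t ht hut => ⟨hut, fun h => hn t ht (Or.inr h.symm)⟩⟩)
    rw [Finset.card_insert_of_notMem huT] at this
    omega
  exact (Finset.card_le_card hcov).trans
    (Finset.card_biUnion_le_card_mul _ _ _ fun t ht => h t (hTS ht))

theorem blockade_pair {H : SimpleGraph V} {U X Y : Finset V} {w : ℝ} (hX : X ⊆ U) (hY : Y ⊆ U)
    (hd : Disjoint X Y) (ha : AnticompletePair H X Y) (hXw : w ≤ X.card) (hYw : w ≤ Y.card) :
    Blockade H U 2 w := by
  have one : ∀ Z : Finset V, w ≤ Z.card → Blockade H Z 1 w := fun Z hZ =>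
    ⟨Fin 1, inferInstance, fun _ => Z, by simp, fun _ => ⟨subset_rfl, hZ⟩,
      fun i j hij => absurd (Subsingleton.elim i j) hij⟩
  exact Blockade.sum hX hY hd ha (one X hXw) (one Y hYw)

theorem NoBlockade.two_pow_lt_card {U : Finset V} {d : ℕ} (hU : NoBlockade G U d)
    (hU2 : 2 ≤ U.card) : (2 : ℝ) ^ d < U.card := by
  obtain ⟨u, hu, w, hw, huw⟩ := Finset.one_lt_card.1 hU2
  have hB : ∀ H : SimpleGraph V, ¬ H.Adj u w → Blockade H U 2 1 := fun H h =>
    blockade_pair (X := {u}) (Y := {w}) (by simpa) (by simpa) (by simpa)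
      (fun a ha b hb => by
        rw [Finset.mem_singleton.1 ha, Finset.mem_singleton.1 hb]
        exact h) (by simp) (by simp)
  by_cases h : G.Adj u w
  · simpa using hU 2 le_rfl Gᶜ (Or.inr rfl) 1 (hB _ fun h' => h'.2 h)
  · simpa using hU 2 le_rfl G (Or.inl rfl) 1 (hB _ h)

theorem NoBlockade.noPurePair {U : Finset V} {d : ℕ} (hU : NoBlockade G U d) :
    NoPurePair G U (U.card / 2 ^ d) := by
  have h : ∀ H, (H = G ∨ H = Gᶜ) → ∀ X ⊆ U, ∀ Y ⊆ U, Disjoint X Y → AnticompletePair H X Y →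
      (X.card : ℝ) < U.card / 2 ^ d ∨ (Y.card : ℝ) < U.card / 2 ^ d := by
    intro H hH X hX Y hY hd ha
    by_contra! hc
    have := hU 2 le_rfl H hH _ (blockade_pair hX hY hd ha hc.1 hc.2)
    rw [Nat.cast_ofNat, div_mul_cancel₀ _ (by positivity)] at this
    exact lt_irrefl _ this
  exact ⟨h G (Or.inl rfl), h Gᶜ (Or.inr rfl)⟩

/-- The maximum closed degree of `G[S]`, divided by `|S|`. -/
noncomputable def density (G : SimpleGraph V) (S : Finset V) : ℝ := maxClN G S / S.card

theorem density_le {S : Finset V} {x : ℝ} (hS : S.Nonempty)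
    (h : ∀ w ∈ S, ((clN G w S).card : ℝ) ≤ x * S.card) (hx : 0 ≤ x) : density G S ≤ x := by
  have hS' : (0 : ℝ) < S.card := by exact_mod_cast Finset.card_pos.2 hS
  exact (div_le_iff₀ hS').2 (maxClN_le (by positivity) h)

theorem density_mul {S : Finset V} (hS : S.Nonempty) :
    density G S * S.card = maxClN G S := by
  have hS' : (0 : ℝ) < S.card := by exact_mod_cast Finset.card_pos.2 hS
  exact div_mul_cancel₀ _ hS'.ne'

theorem density_pos {S : Finset V} (hS : S.Nonempty) : 0 < density G S := by
  obtain ⟨v, hv⟩ := hS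
  have hS' : (0 : ℝ) < S.card := by exact_mod_cast Finset.card_pos.2 ⟨v, hv⟩
  have h1 : 0 < maxClN G S :=
    (Finset.card_pos.2 ⟨v, self_mem_clN hv⟩).trans_le (card_clN_le_maxClN hv)
  have h2 : (0 : ℝ) < maxClN G S := by exact_mod_cast h1
  exact div_pos h2 hS'

theorem HouseFree.exists_sparse_of_noBlockade (hG : HouseFree G) {U : Finset V} {d : ℕ}
    (hd : 2400 ≤ d) (hU : NoBlockade G U d) (hU2 : 2 ≤ U.card) :
    ∃ S ⊆ U, S.Nonempty ∧ density G S ≤ 1 / 2 ^ 100 ∧ density G S ^ 60 * U.card ≤ S.card := by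
  have hd2 : (2 : ℝ) ^ 250 ≤ 2 ^ d := pow_le_pow_right₀ (by norm_num) (by omega)
  have hN := hU.two_pow_lt_card hU2
  have hN0 : (0 : ℝ) < U.card := lt_trans (by positivity) hN
  obtain ⟨S, hS, hSc, hSd⟩ := hG.exists_sparse_subset (m := U.card / 2 ^ d) (e := 1 / 2 ^ 105)
    (by rw [le_div_iff₀ (by positivity)]; linarith) hU.noPurePair (by norm_num) (by norm_num) (by
      calc 100 * ((U.card : ℝ) / 2 ^ d) ≤ 100 * (U.card / 2 ^ 250) := by gcongr
        _ = 100 / 2 ^ 250 * U.card := by ring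
        _ ≤ _ := mul_le_mul_of_nonneg_right (by norm_num) hN0.le)
  have hS0 : (0 : ℝ) < S.card := lt_of_lt_of_le (by positivity) hSc
  have hSn : S.Nonempty := Finset.card_pos.1 (by exact_mod_cast hS0)
  have h1 : density G S ≤ 1 / 2 ^ 100 := by
    refine (density_le hSn hSd (by norm_num)).trans (by norm_num)
  refine ⟨S, hS, hSn, h1, le_trans (mul_le_mul_of_nonneg_right ?_ hN0.le) hSc⟩
  calc density G S ^ 60 ≤ (1 / 2 ^ 100) ^ 60 := pow_le_pow_left₀ (density_pos hSn).le h1 _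
    _ ≤ _ := by norm_num

/-- A house-free graph without large blockades contains a polynomially large stable set. -/
theorem HouseFree.exists_stable_of_noBlockade (hG : HouseFree G) {U : Finset V} {d : ℕ}
    (hd : 2400 ≤ d) (hU : NoBlockade G U d) (hU2 : 2 ≤ U.card) :
    ∃ T ⊆ U, Gᶜ.IsClique (T : Set V) ∧ (U.card : ℝ) ≤ (T.card : ℝ) ^ 120 := by
  obtain ⟨S₀, hS₀U, hS₀n, hS₀d, hS₀c⟩ := hG.exists_sparse_of_noBlockade hd hU hU2
  obtain ⟨S, hS, hmin⟩ := Finset.exists_min_image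
    (U.powerset.filter (fun S => S.Nonempty ∧ density G S ^ 60 * U.card ≤ (S.card : ℝ)))
    (density G) ⟨S₀, Finset.mem_filter.2 ⟨Finset.mem_powerset.2 hS₀U, hS₀n, hS₀c⟩⟩
  obtain ⟨hSU, hSn, hSc⟩ := Finset.mem_filter.1 hS
  have hSU := Finset.mem_powerset.1 hSU
  have hy : density G S ≤ 1 / 2 ^ 100 :=
    (hmin S₀ (Finset.mem_filter.2 ⟨Finset.mem_powerset.2 hS₀U, hS₀n, hS₀c⟩)).trans hS₀d
  have hy0 := density_pos (G := G) hSn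
  have hs0 : (0 : ℝ) < S.card := by exact_mod_cast Finset.card_pos.2 hSn
  obtain ⟨T, hTS, hTc, hT⟩ := exists_stable_of_card_clN_le (G := G) (S := S) (D := maxClN G S)
    fun w hw => card_clN_le_maxClN hw
  refine ⟨T, hTS.trans hSU, hTc, ?_⟩
  have hTy : 1 ≤ T.card * density G S := by
    have h1 : (S.card : ℝ) ≤ T.card * maxClN G S := by exact_mod_cast hT
    rw [← density_mul hSn] at h1
    refine le_of_mul_le_mul_right ?_ hs0
    linarith
  by_contra hcon
  rw [not_le] at hcon
  set q := Real.sqrt (density G S) with hqdef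
  have hqy : q ^ 2 = density G S := Real.sq_sqrt hy0.le
  have hq0 : 0 < q := Real.sqrt_pos.2 hy0
  have hq : q ≤ 1 / 2 ^ 50 := by
    refine le_of_sq_le_sq ?_ (by norm_num)
    rw [hqy]
    exact hy.trans (by norm_num)
  rw [← hqy] at hTy hSc
  have hbig : 1 < q ^ 240 * U.card := by
    calc 1 ≤ ((T.card : ℝ) * q ^ 2) ^ 120 := one_le_pow₀ hTy
      _ = q ^ 240 * (T.card : ℝ) ^ 120 := by rw [mul_pow, ← pow_mul]; ring
      _ < _ := mul_lt_mul_of_pos_left hcon (by positivity)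
  rw [← pow_mul] at hSc
  have hdeg : ∀ w ∈ S, ((clN G w S).card : ℝ) ≤ q ^ 2 * S.card := by
    intro w hw
    rw [hqy, density_mul hSn]
    exact_mod_cast card_clN_le_maxClN hw
  have hstuck : ∀ R ⊆ S, q ^ 120 * S.card ≤ R.card →
      ∃ w ∈ R, q ^ 4 * R.card < (clN G w R).card := by
    intro R hR hRc
    by_contra hc
    simp only [not_exists, not_and, not_lt] at hc
    have hR0 : (0 : ℝ) < R.card := lt_of_lt_of_le (by positivity) hRc
    have hRn : R.Nonempty := Finset.card_pos.1 (by exact_mod_cast hR0)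
    have hRd := density_le hRn hc (by positivity)
    have h1 := hmin R (Finset.mem_filter.2 ⟨Finset.mem_powerset.2 (hR.trans hSU), hRn, by
      calc density G R ^ 60 * U.card ≤ (q ^ 4) ^ 60 * U.card := by
            have := (density_pos (G := G) hRn).le
            gcongr
        _ = q ^ 120 * (q ^ 120 * U.card) := by ring
        _ ≤ q ^ 120 * S.card := mul_le_mul_of_nonneg_left hSc (by positivity)
        _ ≤ _ := hRc⟩)
    rw [← hqy] at h1
    have h2 : q ^ 2 * q ^ 2 ≤ q ^ 2 * (1 / 2 ^ 100) :=
      mul_le_mul_of_nonneg_left (hqy.le.trans hy) (by positivity)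
    have h3 : 0 < q ^ 2 := by positivity
    nlinarith
  set k := ⌊1 / (2 * q)⌋₊ with hk
  have hk1 : (k : ℝ) * (2 * q) ≤ 1 := by
    rw [← le_div_iff₀ (by positivity)]
    exact Nat.floor_le (by positivity)
  have hk2 : 1 < (k + 1 : ℝ) * (2 * q) := by
    rw [← div_lt_iff₀ (by positivity)]
    exact Nat.lt_floor_add_one _
  have hk3 : (1 : ℝ) / 4 ≤ k * q := by linarith
  have hk4 : (2 : ℝ) ≤ k := by
    by_contra! hc
    nlinarith
  have hB := blockade_of_extract (G := G) (S := S) (m := q ^ 124 * S.card) (x := q * S.card)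
    (c := S.card / 2)
    (fun W hW hWc => hG.exists_small_clNSet hd hU hq0 hq hSU hSc hbig hdeg hstuck hW hWc)
    (by positivity) k S subset_rfl (by nlinarith)
  refine hU.false (l := 2) (m := 0) (n := 244) (x := q) (by exact_mod_cast hk4) (Or.inl rfl)
    (hB.mono hSU le_rfl) (by positivity) ?_ ?_ (by omega)
  · calc q ^ 244 * (U.card : ℝ) = q ^ 124 * (q ^ 120 * U.card) := by ring
      _ ≤ q ^ 124 * S.card := mul_le_mul_of_nonneg_left hSc (by positivity)
      _ = _ := by ring
  · have h1 : (1 / 4 : ℝ) * (1 / 4) ≤ (k * q) * (k * q) := by gcongr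
    by_contra! hc
    nlinarith

end Main

section Final
variable {V : Type*} {G : SimpleGraph V}

/-- Some clique and some stable set in `U` have sizes whose product is at least `|U| ^ (1 / d)`. -/
def HasCliqueStable (G : SimpleGraph V) (U : Finset V) (d : ℕ) : Prop :=
  ∃ A ⊆ U, ∃ B ⊆ U, G.IsClique (A : Set V) ∧ Gᶜ.IsClique (B : Set V) ∧
    U.card ≤ (A.card * B.card) ^ d

theorem HasCliqueStable.compl {U : Finset V} {d : ℕ} (h : HasCliqueStable G U d) :
    HasCliqueStable Gᶜ U d := by
  obtain ⟨A, hA, B, hB, hAc, hBc, h⟩ := h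
  exact ⟨B, hB, A, hA, hBc, by rwa [compl_compl], by rwa [mul_comm]⟩

theorem HasCliqueStable.of_blockade {U : Finset V} {d k : ℕ} {w : ℝ} (hk : 2 ≤ k)
    (hU : 0 < U.card) (hB : Blockade G U k w) (hw : (U.card : ℝ) ≤ w * (k : ℝ) ^ d)
    (ih : ∀ X ⊆ U, 0 < X.card → X.card < U.card → HasCliqueStable G X d) :
    HasCliqueStable G U d := by
  obtain ⟨ι, _, X, hι, hX, hXX⟩ := hB
  have hU' : (0 : ℝ) < U.card := by exact_mod_cast hU
  have hk0 : (0 : ℝ) < k := by exact_mod_cast (by omega : 0 < k)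
  have hw0 : 0 < w := by
    by_contra! hc
    have : w * (k : ℝ) ^ d ≤ 0 := mul_nonpos_of_nonpos_of_nonneg hc (by positivity)
    linarith
  have hX0 : ∀ i, 0 < (X i).card := fun i => by
    exact_mod_cast hw0.trans_le (hX i).2
  have : Nontrivial ι := Fintype.one_lt_card_iff_nontrivial.1 (by omega)
  have hXU : ∀ i, (X i).card < U.card := by
    intro i
    obtain ⟨j, hj⟩ := exists_ne i
    have h1 := Finset.card_le_card (Finset.union_subset (hX i).1 (hX j).1)
    rw [Finset.card_union_of_disjoint (hXX i j hj.symm).1] at h1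
    have := hX0 j
    omega
  choose A hA B hBX hAc hBc hAB using fun i => ih (X i) (hX i).1 (hX0 i) (hXU i)
  obtain ⟨i₀, -, hi₀⟩ := Finset.exists_max_image Finset.univ (fun i => (A i).card)
    Finset.univ_nonempty
  obtain ⟨i₁, -, hi₁⟩ := Finset.exists_min_image Finset.univ
    (fun i => (A i).card * (B i).card) Finset.univ_nonempty
  refine ⟨A i₀, (hA i₀).trans (hX i₀).1, Finset.univ.biUnion B,
    Finset.biUnion_subset.2 fun i _ => (hBX i).trans (hX i).1, hAc i₀, ?_, ?_⟩
  · intro a ha b hb hab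
    simp only [Finset.coe_biUnion, Set.mem_iUnion] at ha hb
    obtain ⟨i, -, hi⟩ := ha
    obtain ⟨j, -, hj⟩ := hb
    by_cases hij : i = j
    · subst hij
      exact hBc i hi hj hab
    · exact ⟨hab, (hXX i j hij).2 a (hBX i hi) b (hBX j hj)⟩
  · have hdis : (Finset.univ.biUnion B).card = ∑ i, (B i).card :=
      Finset.card_biUnion fun i _ j _ hij => (hXX i j hij).1.mono (hBX i) (hBX j)
    have hsum : k * ((A i₁).card * (B i₁).card) ≤
        (A i₀).card * (Finset.univ.biUnion B).card := by
      rw [hdis, Finset.mul_sum]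
      calc k * ((A i₁).card * (B i₁).card) = ∑ i : ι, (A i₁).card * (B i₁).card := by
            rw [Finset.sum_const, Finset.card_univ, hι, smul_eq_mul]
        _ ≤ ∑ i, (A i).card * (B i).card := Finset.sum_le_sum fun i _ => hi₁ i (Finset.mem_univ i)
        _ ≤ _ := Finset.sum_le_sum fun i _ =>
          Nat.mul_le_mul_right _ (hi₀ i (Finset.mem_univ i))
    have h1 : (U.card : ℝ) ≤ (((k * ((A i₁).card * (B i₁).card)) ^ d : ℕ) : ℝ) := by
      have h2 : ((X i₁).card : ℝ) ≤ (((A i₁).card * (B i₁).card) ^ d : ℕ) :=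
        Nat.cast_le.2 (hAB i₁)
      calc (U.card : ℝ) ≤ w * (k : ℝ) ^ d := hw
        _ ≤ (((A i₁).card * (B i₁).card) ^ d : ℕ) * (k : ℝ) ^ d :=
          mul_le_mul_of_nonneg_right ((hX i₁).2.trans h2) (by positivity)
        _ = _ := by push_cast; rw [mul_pow]; ring
    exact (Nat.cast_le.1 h1).trans (Nat.pow_le_pow_left hsum d)

theorem HouseFree.hasCliqueStable (hG : HouseFree G) {d : ℕ} (hd : 2400 ≤ d) (n : ℕ) :
    ∀ U : Finset V, U.card = n → 0 < U.card → HasCliqueStable G U d := by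
  induction n using Nat.strong_induction_on with
  | _ n ih =>
    intro U hn hU0
    have ih' : ∀ X ⊆ U, 0 < X.card → X.card < U.card → HasCliqueStable G X d :=
      fun X _ h0 h => ih X.card (hn ▸ h) X rfl h0
    obtain ⟨u, hu⟩ := Finset.card_pos.1 hU0
    have husub : {u} ⊆ U := Finset.singleton_subset_iff.2 hu
    by_cases hU2 : 2 ≤ U.card
    · by_cases hU : NoBlockade G U d
      · obtain ⟨T, hTU, hTc, hT⟩ := hG.exists_stable_of_noBlockade hd hU hU2
        have hT' : U.card ≤ T.card ^ 120 := by exact_mod_cast hT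
        refine ⟨{u}, husub, T, hTU, by simp, hTc, ?_⟩
        rw [Finset.card_singleton, one_mul]
        rcases Nat.eq_zero_or_pos T.card with h0 | h0
        · rw [h0, zero_pow (by norm_num)] at hT'
          omega
        · exact hT'.trans (Nat.pow_le_pow_right h0 (by omega))
      · simp only [NoBlockade, not_forall, not_lt] at hU
        obtain ⟨k, hk, H, hH, w, hB, hw⟩ := hU
        rcases hH with rfl | rfl
        · exact HasCliqueStable.of_blockade hk hU0 hB hw ih'
        · have := HasCliqueStable.of_blockade hk hU0 hB hw
            fun X hX h0 h => (ih' X hX h0 h).compl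
          simpa using this.compl
    · refine ⟨{u}, husub, {u}, husub, by simp, by simp, ?_⟩
      simp only [Finset.card_singleton, mul_one, one_pow]
      omega

end Final

end P5EH

/-- `P5` has the Erdős–Hajnal property. -/
theorem p5_erdos_hajnal :
    ∃ τ : ℝ, 0 < τ ∧
      ∀ (V : Type) [Fintype V] (G : SimpleGraph V),
        Free P5 G → 1 ≤ Fintype.card V →
        ∃ S : Finset V, (G.IsClique (S : Set V) ∨ Gᶜ.IsClique (S : Set V)) ∧
          (Fintype.card V : ℝ) ^ τ ≤ (S.card : ℝ) := by
  refine ⟨1 / 4800, by norm_num, fun V _ G hG hV => ?_⟩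
  obtain ⟨A, -, B, -, hA, hB, hAB⟩ := (P5EH.houseFree_compl hG).hasCliqueStable
    (d := 2400) le_rfl _ Finset.univ rfl (by rwa [Finset.card_univ])
  rw [Finset.card_univ] at hAB
  rw [compl_compl] at hB
  obtain ⟨S, hS, hS1, hS2⟩ : ∃ S : Finset V, (G.IsClique (S : Set V) ∨ Gᶜ.IsClique (S : Set V)) ∧
      A.card ≤ S.card ∧ B.card ≤ S.card := by
    rcases le_total A.card B.card with h | h
    · exact ⟨B, Or.inl hB, h, le_rfl⟩
    · exact ⟨A, Or.inr hA, le_rfl, h⟩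
  refine ⟨S, hS, ?_⟩
  have h1 : Fintype.card V ≤ S.card ^ 4800 :=
    calc Fintype.card V ≤ (A.card * B.card) ^ 2400 := hAB
      _ ≤ (S.card ^ 2) ^ 2400 := Nat.pow_le_pow_left (by nlinarith) _
      _ = S.card ^ (2 * 2400) := (pow_mul _ _ _).symm
  have h2 : (Fintype.card V : ℝ) ≤ (S.card : ℝ) ^ (4800 : ℕ) := by exact_mod_cast h1
  calc (Fintype.card V : ℝ) ^ (1 / 4800 : ℝ) ≤ ((S.card : ℝ) ^ (4800 : ℕ)) ^ (1 / 4800 : ℝ) :=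
        Real.rpow_le_rpow (Nat.cast_nonneg _) h2 (by norm_num)
    _ = S.card := by
        rw [one_div]
        exact Real.pow_rpow_inv_natCast (Nat.cast_nonneg _) (by norm_num)
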